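/- arXiv:2512.13218 — 5 statements merged into one kernel-verified Lean document; each statement's English description precedes it below -/
import Mathlib

section
/- Let X be a full subcategory of a triangulated category. Suppose there are two triangles Y → X → Z → Y[1] and Y' → X' → Z → Y'[1] such that both morphisms X → Z and X' → Z are right X-approximations of Z. Then Y ⊕ X' ≅ Y' ⊕ X. -/
open CategoryTheory CategoryTheory.Limits CategoryTheory.Pretriangulated

universe v u

namespace PaperAIR

variable {C : Type u} [Category.{v} C] [Preadditive C] [HasZeroObject C]
  [HasShift C ℤ] [∀ n : ℤ, (shiftFunctor C n).Additive] [Pretriangulated C]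

/-- `f : X ⟶ Y` is a right `𝒳`-approximation of `Y` (relative to `𝒳 ∋ X`). -/
def IsRightApprox (𝒳 : Set C) {X Y : C} (f : X ⟶ Y) : Prop :=
  X ∈ 𝒳 ∧ ∀ X' ∈ 𝒳, ∀ g : X' ⟶ Y, ∃ h : X' ⟶ X, h ≫ f = g

/-- `𝒳` is contravariantly finite in `C`: every object admits a right `𝒳`-approximation. -/
def ContravariantlyFinite (𝒳 : Set C) : Prop :=
  ∀ Y : C, ∃ (X : C) (f : X ⟶ Y), IsRightApprox 𝒳 f

/-- `𝒳` is contravariantly finite in the full subcategory `𝒞`. -/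
def ContravariantlyFiniteIn (𝒞 𝒳 : Set C) : Prop :=
  ∀ Y ∈ 𝒞, ∃ (X : C) (f : X ⟶ Y), IsRightApprox 𝒳 f

/-- `𝒮` is presilting: `Hom(𝒮, 𝒮[i]) = 0` for all `i > 0`. -/
def IsPresilting (𝒮 : Set C) : Prop :=
  ∀ X ∈ 𝒮, ∀ Y ∈ 𝒮, ∀ i : ℤ, 0 < i → ∀ f : X ⟶ Y⟦i⟧, f = 0

/-- a (strictly full) triangulated subcategory, given by its class of objects. -/
structure IsTriangSub (T : Set C) : Prop where
  iso_closed : ∀ (X Y : C), (X ≅ Y) → X ∈ T → Y ∈ T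
  zero_mem : ∀ X : C, IsZero X → X ∈ T
  shift_mem : ∀ X ∈ T, X⟦(1 : ℤ)⟧ ∈ T
  unshift_mem : ∀ X ∈ T, X⟦(-1 : ℤ)⟧ ∈ T
  ext_mem : ∀ (T' : Triangle C), T' ∈ (distTriang C) → T'.obj₁ ∈ T → T'.obj₃ ∈ T → T'.obj₂ ∈ T

/-- a thick subcategory: a triangulated subcategory closed under direct summands. -/
structure IsThickSub (T : Set C) extends IsTriangSub T : Prop where
  summand_mem : ∀ (X Y : C) (i : X ⟶ Y) (r : Y ⟶ X), i ≫ r = 𝟙 X → Y ∈ T → X ∈ T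

/-- the smallest thick subcategory containing `𝒮`. -/
def thickClosure (𝒮 : Set C) : Set C :=
  {X | ∀ T : Set C, IsThickSub T → 𝒮 ⊆ T → X ∈ T}

/-- `𝒮` is a silting subcategory of `C`: presilting, and the smallest triangulated
subcategory containing `𝒮` is `C` itself. -/
def IsSilting (𝒮 : Set C) : Prop :=
  IsPresilting 𝒮 ∧ ∀ T : Set C, IsTriangSub T → 𝒮 ⊆ T → ∀ X : C, X ∈ T

/-- `𝒮` is a silting subcategory of the (thick, triangulated) subcategory `𝒦`:
presilting, and the smallest triangulated subcategory containing `𝒮` is `𝒦`. -/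
def IsSiltingIn (𝒦 𝒮 : Set C) : Prop :=
  𝒮 ⊆ 𝒦 ∧ IsPresilting 𝒮 ∧ ∀ T : Set C, IsTriangSub T → 𝒮 ⊆ T → 𝒦 ⊆ T

/-- the shift `𝒮[n]` of a class of objects (closed under isomorphism). -/
def shiftSet (𝒮 : Set C) (n : ℤ) : Set C :=
  {X | ∃ Y ∈ 𝒮, Nonempty (X ≅ Y⟦n⟧)}

/-- `𝒜 ∗ ℬ`: objects `Z` fitting in a triangle `A → Z → B → A[1]` with `A ∈ 𝒜`, `B ∈ ℬ`. -/
def star (𝒜 ℬ : Set C) : Set C :=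
  {Z | ∃ (A B : C) (_ : A ∈ 𝒜) (_ : B ∈ ℬ) (f : A ⟶ Z) (g : Z ⟶ B) (h : B ⟶ A⟦(1 : ℤ)⟧),
      Triangle.mk f g h ∈ (distTriang C)}

/-- `𝒮^{[p, p+n]} = 𝒮[p] ∗ 𝒮[p+1] ∗ ⋯ ∗ 𝒮[p+n]`. -/
def intervalFrom (𝒮 : Set C) (p : ℤ) : ℕ → Set C
  | 0 => shiftSet 𝒮 p
  | n + 1 => star (shiftSet 𝒮 p) (intervalFrom 𝒮 (p + 1) n)

/-- `C_𝒳^{≤ 0}`: objects `Y` with `Hom(𝒳, Y[i]) = 0` for all `i > 0`. -/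
def leZeroSet (𝒳 : Set C) : Set C :=
  {Y | ∀ X ∈ 𝒳, ∀ i : ℤ, 0 < i → ∀ f : X ⟶ Y⟦i⟧, f = 0}

/-- `C_𝒳^{≥ 0}`: objects `Y` with `Hom(𝒳, Y[i]) = 0` for all `i < 0`. -/
def geZeroSet (𝒳 : Set C) : Set C :=
  {Y | ∀ X ∈ 𝒳, ∀ i : ℤ, i < 0 → ∀ f : X ⟶ Y⟦i⟧, f = 0}

/-- `(L, G)` is a `t`-structure (with `L = D^{≤0}`, `G = D^{≥0}`). -/
structure IsTStr (L G : Set C) : Prop where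
  iso_le : ∀ (X Y : C), (X ≅ Y) → X ∈ L → Y ∈ L
  iso_ge : ∀ (X Y : C), (X ≅ Y) → X ∈ G → Y ∈ G
  shift_le : ∀ X ∈ L, X⟦(1 : ℤ)⟧ ∈ L
  shift_ge : ∀ X ∈ G, X⟦(-1 : ℤ)⟧ ∈ G
  hom_zero : ∀ X ∈ L, ∀ Y : C, Y⟦(1 : ℤ)⟧ ∈ G → ∀ f : X ⟶ Y, f = 0
  exists_tri : ∀ X : C, ∃ (A B : C) (f : A ⟶ X) (g : X ⟶ B) (h : B ⟶ A⟦(1 : ℤ)⟧),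
      Triangle.mk f g h ∈ (distTriang C) ∧ A ∈ L ∧ B⟦(1 : ℤ)⟧ ∈ G

/-- the `d`-extended heart `d`-`H = D^{≤0} ∩ D^{≥ -d+1}` of the `t`-structure
`(D_P^{≤0}, D_P^{≥0})` associated with `P`. -/
def extHeart (P : Set C) (d : ℕ) : Set C :=
  {X | X ∈ leZeroSet P ∧ X⟦(1 - (d : ℤ))⟧ ∈ geZeroSet P}

/-- an extriangle `A → B → Z` in the `d`-extended heart. -/
def Extriangle (P : Set C) (d : ℕ) (A B Z : C) : Prop :=
  A ∈ extHeart P d ∧ B ∈ extHeart P d ∧ Z ∈ extHeart P d ∧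
    ∃ (f : A ⟶ B) (g : B ⟶ Z) (h : Z ⟶ A⟦(1 : ℤ)⟧), Triangle.mk f g h ∈ (distTriang C)

/-- `Fac_s(𝒳)`: the `s`-factors of `𝒳` inside the `d`-extended heart. -/
def Fac (P : Set C) (d : ℕ) (𝒳 : Set C) : ℕ → Set C
  | 0 => extHeart P d
  | s + 1 => {Z | ∃ Z' ∈ Fac P d 𝒳 s, ∃ B ∈ 𝒳, Extriangle P d Z' B Z}

/-- `T(𝒮) = {X ∈ d-H ∣ Hom(𝒮, X[i]) = 0 for i > 0}`. -/
def TClass (P : Set C) (d : ℕ) (𝒮 : Set C) : Set C :=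
  {X | X ∈ extHeart P d ∧ ∀ A ∈ 𝒮, ∀ i : ℤ, 0 < i → ∀ f : A ⟶ X⟦i⟧, f = 0}

/-- `F(𝒮) = {X ∈ d-H ∣ Hom(𝒮, X[i]) = 0 for i ≤ 0}`. -/
def FClass (P : Set C) (d : ℕ) (𝒮 : Set C) : Set C :=
  {X | X ∈ extHeart P d ∧ ∀ A ∈ 𝒮, ∀ i : ℤ, i ≤ 0 → ∀ f : A ⟶ X⟦i⟧, f = 0}

/-- `(𝒯, ℱ)` is an `s`-torsion pair in the `d`-extended heart. -/
def IsSTorsionPair (P : Set C) (d : ℕ) (𝒯 ℱ : Set C) : Prop :=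
  (∀ T ∈ 𝒯, ∀ F ∈ ℱ, ∀ f : T ⟶ F, f = 0) ∧
  (∀ T ∈ 𝒯, ∀ F ∈ ℱ, ∀ f : T ⟶ F⟦(-1 : ℤ)⟧, f = 0) ∧
  (∀ X ∈ extHeart P d, ∃ (T' : C) (_ : T' ∈ 𝒯) (F' : C) (_ : F' ∈ ℱ), Extriangle P d T' X F')

/-- `M` is (a representative of) `H^{[-d+1,0]}(S)`: there is a triangle
`W → S → M → W[1]` with `W ∈ D^{≤ -d}` and `M ∈ d-H`. -/
def IsHTrunc (P : Set C) (d : ℕ) (S M : C) : Prop :=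
  M ∈ extHeart P d ∧
    ∃ (W : C) (f : W ⟶ S) (g : S ⟶ M) (h : M ⟶ W⟦(1 : ℤ)⟧),
      Triangle.mk f g h ∈ (distTriang C) ∧ W⟦-(d : ℤ)⟧ ∈ leZeroSet P

/-- `H^{[-d+1,0]}(𝒮)` as a class of objects. -/
def hTruncSet (P : Set C) (d : ℕ) (𝒮 : Set C) : Set C :=
  {M | ∃ S ∈ 𝒮, IsHTrunc P d S M}

/-- the additive closure of a class of objects: closure under finite direct sums
(expressed via binary biproduct diagrams and zero objects) and direct summands. -/
inductive AddClos (𝒮 : Set C) : C → Prop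
  | of (X : C) (hX : X ∈ 𝒮) : AddClos 𝒮 X
  | zero (X : C) (hX : IsZero X) : AddClos 𝒮 X
  | biprod (X Y Z : C) (i₁ : X ⟶ Z) (i₂ : Y ⟶ Z) (p₁ : Z ⟶ X) (p₂ : Z ⟶ Y)
      (h₁ : i₁ ≫ p₁ = 𝟙 X) (h₂ : i₂ ≫ p₂ = 𝟙 Y) (h₁₂ : i₁ ≫ p₂ = 0) (h₂₁ : i₂ ≫ p₁ = 0)
      (htot : p₁ ≫ i₁ + p₂ ≫ i₂ = 𝟙 Z) (hX : AddClos 𝒮 X) (hY : AddClos 𝒮 Y) : AddClos 𝒮 Z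
  | summand (X Y : C) (i : X ⟶ Y) (r : Y ⟶ X) (hir : i ≫ r = 𝟙 X) (hY : AddClos 𝒮 Y) :
      AddClos 𝒮 X

/-- `add 𝒮` as a set. -/
def addSet (𝒮 : Set C) : Set C := {X | AddClos 𝒮 X}

/-- `𝒮` is a `P`-presentation of `ℳ ⊆ d-H`: a `(d+1)`-term subcategory of `K`
with `add H^{[-d+1,0]}(𝒮) = ℳ`. -/
def IsPPresentation (P : Set C) (d : ℕ) (ℳ 𝒮 : Set C) : Prop :=
  𝒮 ⊆ intervalFrom P 0 d ∧ addSet (hTruncSet P d 𝒮) = ℳ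

/-- `ℳ` is AIR tilting with respect to its `P`-presentation `𝒮`. -/
def IsAIRTiltingWrt (P : Set C) (d : ℕ) (ℳ 𝒮 : Set C) : Prop :=
  IsPPresentation P d ℳ 𝒮 ∧ ContravariantlyFinite 𝒮 ∧ TClass P d 𝒮 = Fac P d ℳ d

/-- `ℳ` is AIR tilting. -/
def IsAIRTilting (P : Set C) (d : ℕ) (ℳ : Set C) : Prop :=
  ∃ 𝒮 : Set C, IsAIRTiltingWrt P d ℳ 𝒮

/-- `ℳ` is a quasi-tilting subcategory of the `d`-extended heart. -/
def IsQuasiTilting (P : Set C) (d : ℕ) (ℳ : Set C) : Prop :=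
  (∀ M ∈ ℳ, ∀ X ∈ Fac P d ℳ d, ∀ f : M ⟶ X⟦(1 : ℤ)⟧, f = 0) ∧
  Fac P d ℳ d = Fac P d ℳ (d + 1)

/-- `M ∈ d-H` has projective dimension at most `m`. -/
def ProjDimLE (P : Set C) (d : ℕ) : ℕ → C → Prop
  | 0, M => M ∈ P
  | m + 1, M => ∃ (Z Q : C), Q ∈ P ∧ ProjDimLE P d m Z ∧ Extriangle P d Z Q M

/-- `ℳ` is a tilting subcategory of the `d`-extended heart. -/
def IsTilting (P : Set C) (d : ℕ) (ℳ : Set C) : Prop :=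
  (∀ M ∈ ℳ, ProjDimLE P d d M) ∧
  (∀ M ∈ ℳ, ∀ M' ∈ ℳ, ∀ i : ℤ, 0 < i → ∀ f : M ⟶ M'⟦i⟧, f = 0) ∧
  (∀ Q ∈ P, ∃ (r : ℕ) (Y : ℕ → C) (M : ℕ → C), Y 0 = Q ∧ Y r ∈ ℳ ∧
      ∀ i < r, M i ∈ ℳ ∧ Extriangle P d (Y i) (M i) (Y (i + 1)))

/-- `ℳ` is an `E`-universal subcategory of the `d`-extended heart. -/
def EUniversal (P : Set C) (d : ℕ) (ℳ : Set C) : Prop :=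
  ∀ X ∈ extHeart P d, ∃ (Y M : C) (_ : M ∈ ℳ) (f : X ⟶ Y) (g : Y ⟶ M)
      (h : M ⟶ X⟦(1 : ℤ)⟧), Triangle.mk f g h ∈ (distTriang C) ∧ Y ∈ extHeart P d ∧
      ∀ M' ∈ ℳ, ∀ e : M' ⟶ X⟦(1 : ℤ)⟧, ∃ φ : M' ⟶ M, φ ≫ h = e

/-- An endomorphism of the first object of a distinguished triangle which extends to an
endomorphism of the triangle by identities is an isomorphism. -/
lemma isIso_of_endomorphism_of_distTriang {Y X Z : C} {u : Y ⟶ X} {f : X ⟶ Z}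
    {w : Z ⟶ Y⟦(1 : ℤ)⟧} (hT : Triangle.mk u f w ∈ (distTriang C)) {e : Y ⟶ Y}
    (hu : e ≫ u = u) (hw : w ≫ e⟦(1 : ℤ)⟧' = w) : IsIso e := by
  let φ : Triangle.mk u f w ⟶ Triangle.mk u f w :=
    { hom₁ := e
      hom₂ := 𝟙 X
      hom₃ := 𝟙 Z
      comm₁ := (Category.comp_id u).trans hu.symm
      comm₂ := (Category.comp_id f).trans (Category.id_comp f).symm
      comm₃ := hw.trans (Category.id_comp w).symm }
  have h₂ : IsIso φ.hom₂ := IsIso.id X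
  have h₃ : IsIso φ.hom₃ := IsIso.id Z
  exact isIso₁_of_isIso₂₃ φ hT hT h₂ h₃

/-- If `b.pt` is the biproduct of `X` and `W`, and `g : b.pt ⟶ Z` vanishes on `W`, then the fibre
of `g` is the biproduct of `W` and the fibre of the restriction of `g` to `X`. -/
lemma nonempty_iso_biprod_of_distTriang [HasBinaryBiproducts C] {Y X Z K W : C}
    {u : Y ⟶ X} {f : X ⟶ Z} {w : Z ⟶ Y⟦(1 : ℤ)⟧} (hT : Triangle.mk u f w ∈ (distTriang C))
    (b : BinaryBicone X W) (total : b.fst ≫ b.inl + b.snd ≫ b.inr = 𝟙 b.pt)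
    {k : K ⟶ b.pt} {g : b.pt ⟶ Z} {h : Z ⟶ K⟦(1 : ℤ)⟧}
    (hK : Triangle.mk k g h ∈ (distTriang C)) (hg : b.fst ≫ f = g) :
    Nonempty (K ≅ Y ⊞ W) := by
  have hinl : b.inl ≫ g = f := by simp [← hg]
  have hinr : b.inr ≫ g = 0 := by simp [← hg]
  obtain ⟨i, hi, hi'⟩ : ∃ i : Y ⟶ K, u ≫ b.inl = i ≫ k ∧ w ≫ i⟦(1 : ℤ)⟧' = 𝟙 Z ≫ h :=
    complete_distinguished_triangle_morphism₁ _ _ hT hK b.inl (𝟙 Z)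
      ((Category.comp_id f).trans hinl.symm)
  obtain ⟨p, hp, hp'⟩ : ∃ p : K ⟶ Y, k ≫ b.fst = p ≫ u ∧ h ≫ p⟦(1 : ℤ)⟧' = 𝟙 Z ≫ w :=
    complete_distinguished_triangle_morphism₁ _ _ hK hT b.fst (𝟙 Z)
      ((Category.comp_id g).trans hg.symm)
  obtain ⟨j, hj⟩ : ∃ j : W ⟶ K, b.inr = j ≫ k := Triangle.coyoneda_exact₂ _ hK b.inr hinr
  rw [Category.id_comp] at hi' hp'
  have hkh : h ≫ k⟦(1 : ℤ)⟧' = 0 := comp_distTriang_mor_zero₃₁ _ hK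
  have hip : IsIso (i ≫ p) := isIso_of_endomorphism_of_distTriang hT
    (by rw [Category.assoc, ← hp, ← reassoc_of% hi, b.inl_fst, Category.comp_id])
    (by rw [Functor.map_comp, reassoc_of% hi', hp'])
  have hε : IsIso (p ≫ i + (k ≫ b.snd) ≫ j) := isIso_of_endomorphism_of_distTriang hK
    (by
      simp only [Preadditive.add_comp, Category.assoc, ← hi, ← hj, ← reassoc_of% hp]
      rw [← Preadditive.comp_add, total, Category.comp_id])
    (by simp only [Functor.map_add, Functor.map_comp, Preadditive.comp_add, Category.assoc,
      reassoc_of% hp', hi', reassoc_of% hkh, zero_comp, add_zero])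
  let φ : K ⟶ Y ⊞ W := biprod.lift p (k ≫ b.snd)
  have hφ : φ ≫ biprod.desc i j = p ≫ i + (k ≫ b.snd) ≫ j := biprod.lift_desc ..
  have hmono : Mono φ := by
    have : Mono (φ ≫ biprod.desc i j) := by rw [hφ]; infer_instance
    exact mono_of_mono φ (biprod.desc i j)
  have hiq : i ≫ k ≫ b.snd = 0 := by simp [← reassoc_of% hi]
  have hjq : j ≫ k ≫ b.snd = 𝟙 W := by simp [← reassoc_of% hj]
  have hinv : inv (i ≫ p) ≫ i ≫ p = 𝟙 Y := IsIso.inv_hom_id _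
  have hsplit : IsSplitEpi φ := ⟨⟨{
    section_ := biprod.desc (inv (i ≫ p) ≫ i) (j - j ≫ p ≫ inv (i ≫ p) ≫ i)
    id := by
      ext <;> simp [φ, -IsIso.inv_comp, hiq, hjq, hinv] }⟩⟩
  have : IsIso φ := isIso_of_mono_of_isSplitEpi φ
  exact ⟨asIso φ⟩

theorem statement1 [HasBinaryBiproducts C] (𝒳 : Set C)
    {Y X Z Y' X' : C}
    (f : X ⟶ Z) (u : Y ⟶ X) (w : Z ⟶ Y⟦(1 : ℤ)⟧)
    (hT : Triangle.mk u f w ∈ (distTriang C))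
    (f' : X' ⟶ Z) (u' : Y' ⟶ X') (w' : Z ⟶ Y'⟦(1 : ℤ)⟧)
    (hT' : Triangle.mk u' f' w' ∈ (distTriang C))
    (hf : IsRightApprox 𝒳 f) (hf' : IsRightApprox 𝒳 f') :
    Nonempty (Y ⊞ X' ≅ Y' ⊞ X) := by
  obtain ⟨a, ha⟩ := hf.2 X' hf'.1 f'
  obtain ⟨b, hb⟩ := hf'.2 X hf.1 f
  obtain ⟨K, k, h, hK⟩ := distinguished_cocone_triangle₁ (biprod.desc f f')
  have htot : (biprod.fst ≫ biprod.inl + biprod.snd ≫ biprod.inr : X ⊞ X' ⟶ X ⊞ X') = 𝟙 _ :=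
    biprod.total
  let B : BinaryBicone X X' :=
    { pt := X ⊞ X'
      fst := biprod.fst + biprod.snd ≫ a
      snd := biprod.snd
      inl := biprod.inl
      inr := biprod.inr - a ≫ biprod.inl }
  let B' : BinaryBicone X' X :=
    { pt := X ⊞ X'
      fst := biprod.snd + biprod.fst ≫ b
      snd := biprod.fst
      inl := biprod.inr
      inr := biprod.inl - b ≫ biprod.inr }
  obtain ⟨e⟩ := nonempty_iso_biprod_of_distTriang hT B
    (by ext <;> simp [B]) hK (by ext <;> simp [B, ha])
  obtain ⟨e'⟩ := nonempty_iso_biprod_of_distTriang hT' B'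
    (by ext <;> simp [B']) hK (by ext <;> simp [B', hb])
  exact ⟨e.symm ≪≫ e'⟩

end PaperAIR
end

section
/- Suppose that P is contravariantly finite in D. Then every object M ∈ d-H admits a P-presentation, i.e., there exists S ∈ P^{[0,d]} with H^{[−d+1,0]}(S) ≅ M; consequently every subcategory M ⊆ d-H admits a P-presentation. -/
open CategoryTheory CategoryTheory.Limits CategoryTheory.Pretriangulated

universe v u

namespace PaperAIR

variable {C : Type u} [Category.{v} C] [Preadditive C] [HasZeroObject C]
  [HasShift C ℤ] [∀ n : ℤ, (shiftFunctor C n).Additive] [Pretriangulated C]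

section ShiftOnly

variable {C : Type u} [Category.{v} C] [HasShift C ℤ]

lemma exists_lift_shift_add_one {P : Set C} {S N : C} {f : S ⟶ N} {k : ℤ}
    (hf : ∀ X ∈ P, ∀ j ≤ k, ∀ g : X⟦j⟧ ⟶ N, ∃ h, h ≫ f = g)
    {X : C} (hX : X ∈ P) {j : ℤ} (hj : j < k) (g : X⟦j⟧⟦(1 : ℤ)⟧ ⟶ N) :
    ∃ h, h ≫ f = g := by
  let e := (shiftFunctorAdd' C j 1 (j + 1) rfl).app X
  obtain ⟨h, hh⟩ := hf X hX (j + 1) (by lia) (e.hom ≫ g)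
  exact ⟨e.inv ≫ h, by rw [Category.assoc, hh, Iso.inv_hom_id_assoc]⟩

lemma ContravariantlyFinite.exists_approx_shift {P : Set C} (hP : ContravariantlyFinite P)
    (p : ℤ) (N : C) :
    ∃ Y ∈ P, ∃ f : Y⟦p⟧ ⟶ N, ∀ X ∈ P, ∀ g : X⟦p⟧ ⟶ N, ∃ h : X⟦p⟧ ⟶ Y⟦p⟧, h ≫ f = g := by
  obtain ⟨Y, a, hY, ha⟩ := hP (N⟦-p⟧)
  let adj := (shiftEquiv' C p (-p) (add_neg_cancel p)).toAdjunction
  refine ⟨Y, hY, (adj.homEquiv Y N).symm a, fun X hX g => ?_⟩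
  obtain ⟨h, hh⟩ := ha X hX (adj.homEquiv X N g)
  exact ⟨h⟦p⟧', (adj.homEquiv_naturality_left_symm h a).symm.trans
    ((Equiv.symm_apply_eq _).2 hh)⟩

end ShiftOnly

section Preadditive

variable {C : Type u} [Category.{v} C] [Preadditive C]

lemma forall_hom_eq_zero_congr_right (X : C) {Y Y' : C} (e : Y ≅ Y') :
    (∀ f : X ⟶ Y, f = 0) ↔ ∀ f : X ⟶ Y', f = 0 := by
  constructor
  · intro H f
    rw [← cancel_mono e.inv, H (f ≫ e.inv), zero_comp]
  · intro H f
    rw [← cancel_mono e.hom, H (f ≫ e.hom), zero_comp]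

lemma AddClos.mono {𝒮 𝒯 : Set C} (h : 𝒮 ⊆ 𝒯) {X : C} (hX : AddClos 𝒮 X) : AddClos 𝒯 X := by
  induction hX with
  | of X hX => exact .of X (h hX)
  | zero X hX => exact .zero X hX
  | biprod X Y Z i₁ i₂ p₁ p₂ h₁ h₂ h₁₂ h₂₁ htot _ _ ihX ihY =>
    exact .biprod X Y Z i₁ i₂ p₁ p₂ h₁ h₂ h₁₂ h₂₁ htot ihX ihY
  | summand X Y i r hir _ ih => exact .summand X Y i r hir ih

end Preadditive

section Shift

variable {C : Type u} [Category.{v} C] [Preadditive C] [HasShift C ℤ]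
  [∀ n : ℤ, (shiftFunctor C n).Additive]

lemma forall_hom_shift_eq_zero_iff (X Y : C) {i j : ℤ} (h : i + j = 0) :
    (∀ f : X⟦i⟧ ⟶ Y, f = 0) ↔ ∀ f : X ⟶ Y⟦j⟧, f = 0 := by
  let e : (X⟦i⟧ ⟶ Y) ≃ (X ⟶ Y⟦j⟧) := (shiftEquiv' C i j h).toAdjunction.homEquiv X Y
  have he : e 0 = 0 := by
    refine (Adjunction.homEquiv_unit _ _ _ _).trans ?_
    exact (congrArg _ ((shiftFunctor C j).map_zero _ _)).trans comp_zero
  constructor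
  · intro H f
    rw [← e.apply_symm_apply f, H (e.symm f), he]
  · intro H f
    exact e.injective ((H (e f)).trans he.symm)

/-- `N` lies in `D_P^{≤ -k}`, tested against the maps from `P[j]`, `j < k`. -/
def VanishesBelow (P : Set C) (k : ℤ) (N : C) : Prop :=
  ∀ X ∈ P, ∀ j < k, ∀ f : X⟦j⟧ ⟶ N, f = 0

lemma vanishesBelow_iff_shift_mem_leZeroSet (P : Set C) (k : ℤ) (N : C) :
    VanishesBelow P k N ↔ N⟦-k⟧ ∈ leZeroSet P := by
  have key (X : C) (j i : ℤ) (h : i + j = k) :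
      (∀ f : X⟦j⟧ ⟶ N, f = 0) ↔ ∀ f : X ⟶ N⟦-k⟧⟦i⟧, f = 0 :=
    (forall_hom_shift_eq_zero_iff X N (add_neg_cancel j)).trans
      (forall_hom_eq_zero_congr_right X
        ((shiftFunctorAdd' C (-k) i (-j) (by lia)).app N))
  constructor
  · intro H X hX i hi
    exact (key X (k - i) i (by lia)).1 (H X hX _ (by lia))
  · intro H X hX j hj
    exact (key X j (k - j) (by lia)).2 (H X hX _ (by lia))

lemma vanishesBelow_zero_iff (P : Set C) (N : C) :
    VanishesBelow P 0 N ↔ N ∈ leZeroSet P := by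
  constructor
  · intro H X hX i hi
    exact (forall_hom_shift_eq_zero_iff X N (neg_add_cancel i)).1 (H X hX _ (by lia))
  · intro H X hX j hj
    exact (forall_hom_shift_eq_zero_iff X N (add_neg_cancel j)).2 (H X hX _ (by lia))

lemma IsPresilting.vanishesBelow_shift {P : Set C} (hP : IsPresilting P) {Y : C} (hY : Y ∈ P)
    (p : ℤ) : VanishesBelow P p (Y⟦p⟧) := by
  intro X hX j hj
  refine (forall_hom_shift_eq_zero_iff X _ (add_neg_cancel j)).2 ?_
  exact (forall_hom_eq_zero_congr_right X
    ((shiftFunctorAdd' C p (-j) (p - j) (by lia)).app Y)).1 (hP X hX Y hY _ (by lia))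

end Shift

section Exactness

variable {X Y Z Q : C} {f : X ⟶ Y} {g : Y ⟶ Z} {h : Z ⟶ X⟦(1 : ℤ)⟧}

lemma exists_lift_mor₁ (hT : Triangle.mk f g h ∈ distTriang C)
    (x : Q ⟶ Y) (hx : x ≫ g = 0) : ∃ y : Q ⟶ X, x = y ≫ f :=
  Triangle.coyoneda_exact₂ _ hT x hx

lemma exists_lift_mor₂ (hT : Triangle.mk f g h ∈ distTriang C)
    (x : Q ⟶ Z) (hx : x ≫ h = 0) : ∃ y : Q ⟶ Y, x = y ≫ g :=
  Triangle.coyoneda_exact₃ _ hT x hx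

lemma exists_lift_mor₃ (hT : Triangle.mk f g h ∈ distTriang C)
    (x : Q ⟶ X⟦(1 : ℤ)⟧) (hx : x ≫ f⟦(1 : ℤ)⟧' = 0) : ∃ y : Q ⟶ Z, x = y ≫ h :=
  Triangle.coyoneda_exact₁ _ hT x hx

lemma exists_desc_mor₂ (hT : Triangle.mk f g h ∈ distTriang C)
    (x : Y ⟶ Q) (hx : f ≫ x = 0) : ∃ y : Z ⟶ Q, x = g ≫ y :=
  Triangle.yoneda_exact₂ _ hT x hx

lemma exists_desc_mor₃ (hT : Triangle.mk f g h ∈ distTriang C)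
    (x : Z ⟶ Q) (hx : g ≫ x = 0) : ∃ y : X⟦(1 : ℤ)⟧ ⟶ Q, x = h ≫ y :=
  Triangle.yoneda_exact₃ _ hT x hx

end Exactness

lemma vanishesBelow_fiber {P : Set C} {W S N : C} {w : W ⟶ S} {f : S ⟶ N} {δ : N ⟶ W⟦(1 : ℤ)⟧}
    (hT : Triangle.mk w f δ ∈ distTriang C) {k : ℤ}
    (hepi : ∀ X ∈ P, ∀ j ≤ k, ∀ g : X⟦j⟧ ⟶ N, ∃ h, h ≫ f = g)
    (hmono : ∀ X ∈ P, ∀ j < k, ∀ g : X⟦j⟧ ⟶ S, g ≫ f = 0 → g = 0) :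
    VanishesBelow P k W := by
  intro X hX j hj g
  have hwf : w ≫ f = 0 := comp_distTriang_mor_zero₁₂ _ hT
  have hfδ : f ≫ δ = 0 := comp_distTriang_mor_zero₂₃ _ hT
  have hg : g ≫ w = 0 := hmono X hX j hj _ (by rw [Category.assoc, hwf, comp_zero])
  obtain ⟨b, hb⟩ := exists_lift_mor₃ hT (g⟦(1 : ℤ)⟧') (by
    rw [← Functor.map_comp, hg, Functor.map_zero])
  obtain ⟨c, rfl⟩ := exists_lift_shift_add_one hepi hX hj b
  apply (shiftFunctor C (1 : ℤ)).map_injective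
  rw [hb, Functor.map_zero, Category.assoc, hfδ, comp_zero]

lemma vanishesBelow_cone {P : Set C} {A N N' : C} {a : A ⟶ N} {b : N ⟶ N'}
    {δ : N' ⟶ A⟦(1 : ℤ)⟧} (hT : Triangle.mk a b δ ∈ distTriang C) {p : ℤ}
    (hA : VanishesBelow P (p + 1) (A⟦(1 : ℤ)⟧)) (hN : VanishesBelow P p N)
    (ha : ∀ X ∈ P, ∀ g : X⟦p⟧ ⟶ N, ∃ h, h ≫ a = g) :
    VanishesBelow P (p + 1) N' := by
  intro X hX j hj g
  obtain ⟨c, rfl⟩ := exists_lift_mor₂ hT g (hA X hX j hj _)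
  rcases (Int.lt_add_one_iff.1 hj).lt_or_eq with h | rfl
  · rw [hN X hX j h c, zero_comp]
  · obtain ⟨e, rfl⟩ := ha X hX c
    have hab : a ≫ b = 0 := comp_distTriang_mor_zero₁₂ _ hT
    rw [Category.assoc, hab, comp_zero]

section FourLemma

variable {A S S' N N' : C} {s : A ⟶ S} {t : S ⟶ S'} {σ : S' ⟶ A⟦(1 : ℤ)⟧}
  {a : A ⟶ N} {b : N ⟶ N'} {δ : N' ⟶ A⟦(1 : ℤ)⟧} {f : S ⟶ N} {f' : S' ⟶ N'}

lemma exists_lift_of_triangle_morphism (hS : Triangle.mk s t σ ∈ distTriang C)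
    (hN : Triangle.mk a b δ ∈ distTriang C)
    (h₁ : s ≫ f = a) (h₂ : t ≫ f' = f ≫ b) (h₃ : f' ≫ δ = σ)
    {Q : C} (hf' : ∀ g : Q ⟶ N', ∃ h, h ≫ f' = g) (g : Q ⟶ N) : ∃ h, h ≫ f = g := by
  have hbδ : b ≫ δ = 0 := comp_distTriang_mor_zero₂₃ _ hN
  obtain ⟨c, hc⟩ := hf' (g ≫ b)
  obtain ⟨e, he⟩ := exists_lift_mor₂ hS c (by
    rw [← h₃, reassoc_of% hc, hbδ, comp_zero])
  obtain ⟨i, hi⟩ := exists_lift_mor₁ hN (g - e ≫ f) (by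
    rw [Preadditive.sub_comp, Category.assoc, ← h₂, ← reassoc_of% he, hc, sub_self])
  refine ⟨e + i ≫ s, ?_⟩
  rw [Preadditive.add_comp, Category.assoc, h₁, ← hi, add_sub_cancel]

lemma eq_zero_of_triangle_morphism (hS : Triangle.mk s t σ ∈ distTriang C)
    (hN : Triangle.mk a b δ ∈ distTriang C)
    (h₁ : s ≫ f = a) (h₂ : t ≫ f' = f ≫ b) (h₃ : f' ≫ δ = σ)
    {Q : C} (hepi : ∀ g : Q⟦(1 : ℤ)⟧ ⟶ N', ∃ h, h ≫ f' = g)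
    (hmono : ∀ g : Q ⟶ S', g ≫ f' = 0 → g = 0) (g : Q ⟶ S) (hg : g ≫ f = 0) : g = 0 := by
  obtain ⟨c, rfl⟩ := exists_lift_mor₁ hS g
    (hmono _ (by rw [Category.assoc, h₂, reassoc_of% hg, zero_comp]))
  rw [Category.assoc, h₁] at hg
  obtain ⟨e, he⟩ := exists_lift_mor₃ hN (c⟦(1 : ℤ)⟧') (by
    rw [← Functor.map_comp, hg, Functor.map_zero])
  obtain ⟨i, rfl⟩ := hepi e
  have hσs : σ ≫ s⟦(1 : ℤ)⟧' = 0 := comp_distTriang_mor_zero₃₁ _ hS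
  apply (shiftFunctor C (1 : ℤ)).map_injective
  rw [Category.assoc, h₃] at he
  rw [Functor.map_comp, he, Category.assoc, hσs, comp_zero, Functor.map_zero]

end FourLemma

lemma exists_mem_intervalFrom_hom {P : Set C} (hP : IsPresilting P)
    (hPcf : ContravariantlyFinite P) (n : ℕ) (p : ℤ) (N : C) (hN : VanishesBelow P p N) :
    ∃ S ∈ intervalFrom P p n, ∃ f : S ⟶ N,
      (∀ X ∈ P, ∀ j ≤ p + n, ∀ g : X⟦j⟧ ⟶ N, ∃ h, h ≫ f = g) ∧
      (∀ X ∈ P, ∀ j < p + n, ∀ g : X⟦j⟧ ⟶ S, g ≫ f = 0 → g = 0) := by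
  induction n generalizing p N with
  | zero =>
    obtain ⟨Y, hY, a, ha⟩ := hPcf.exists_approx_shift p N
    refine ⟨Y⟦p⟧, ⟨Y, hY, ⟨Iso.refl _⟩⟩, a, fun X hX j hj g => ?_, fun X hX j hj g _ => ?_⟩
    · rw [Nat.cast_zero, add_zero] at hj
      rcases hj.lt_or_eq with h | rfl
      · exact ⟨0, by rw [zero_comp, hN X hX j h g]⟩
      · exact ha X hX g
    · exact hP.vanishesBelow_shift hY p X hX j (by simpa using hj) g
  | succ n ih =>
    obtain ⟨Y, hY, a, ha⟩ := hPcf.exists_approx_shift p N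
    obtain ⟨N', b, δ, hT⟩ := distinguished_cocone_triangle a
    have hA : VanishesBelow P (p + 1) (Y⟦p⟧⟦(1 : ℤ)⟧) := fun X hX j hj =>
      (forall_hom_eq_zero_congr_right _ ((shiftFunctorAdd' C p 1 (p + 1) rfl).app Y)).1
        (hP.vanishesBelow_shift hY (p + 1) X hX j hj)
    obtain ⟨S', hS', f', hepi, hmono⟩ := ih (p + 1) N' (vanishesBelow_cone hT hA hN ha)
    obtain ⟨S, s, t, hS⟩ := distinguished_cocone_triangle₂ (f' ≫ δ)
    obtain ⟨f, h₁, h₂⟩ : ∃ f : S ⟶ N, s ≫ f = 𝟙 _ ≫ a ∧ t ≫ f' = f ≫ b :=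
      complete_distinguished_triangle_morphism₂ _ _ hS hT (𝟙 _) f'
        ((congrArg _ ((shiftFunctor C (1 : ℤ)).map_id _)).trans (Category.comp_id _))
    rw [Category.id_comp] at h₁
    have hk : p + ((n + 1 : ℕ) : ℤ) = p + 1 + n := by push_cast; ring
    rw [hk]
    refine ⟨S, ⟨_, S', ⟨Y, hY, ⟨Iso.refl _⟩⟩, hS', s, t, _, hS⟩, f, fun X hX j hj => ?_,
      fun X hX j hj => ?_⟩
    · exact exists_lift_of_triangle_morphism hS hT h₁ h₂ rfl (hepi X hX j hj)
    · exact eq_zero_of_triangle_morphism hS hT h₁ h₂ rfl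
        (exists_lift_shift_add_one hepi hX hj) (hmono X hX j hj)

lemma exists_isHTrunc {P : Set C} (hP : IsPresilting P) (hPcf : ContravariantlyFinite P) (d : ℕ)
    {M : C} (hM : M ∈ extHeart P d) : ∃ S ∈ intervalFrom P 0 d, IsHTrunc P d S M := by
  obtain ⟨S, hS, f, hepi, hmono⟩ :=
    exists_mem_intervalFrom_hom hP hPcf d 0 M ((vanishesBelow_zero_iff P M).2 hM.1)
  rw [zero_add] at hepi hmono
  obtain ⟨W, w, δ, hT⟩ := distinguished_cocone_triangle₁ f
  exact ⟨S, hS, hM, W, w, f, δ, hT,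
    (vanishesBelow_iff_shift_mem_leZeroSet P d W).1 (vanishesBelow_fiber hT hepi hmono)⟩

lemma IsTStr.hom_extHeart_eq_zero {P : Set C} (ht : IsTStr (leZeroSet P) (geZeroSet P)) {d : ℕ}
    {W M : C} (hW : W⟦-(d : ℤ)⟧ ∈ leZeroSet P) (hM : M ∈ extHeart P d) (f : W ⟶ M) : f = 0 := by
  apply (shiftFunctor C (-(d : ℤ))).map_injective
  rw [Functor.map_zero]
  exact ht.hom_zero _ hW _ (ht.iso_ge _ _
    ((shiftFunctorAdd' C (-(d : ℤ)) 1 (1 - (d : ℤ)) (by lia)).app M) hM.2) _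

lemma IsHTrunc.exists_retract {P : Set C} (ht : IsTStr (leZeroSet P) (geZeroSet P)) {d : ℕ}
    {S M M' : C} (h : IsHTrunc P d S M) (h' : IsHTrunc P d S M') :
    ∃ (i : M' ⟶ M) (r : M ⟶ M'), i ≫ r = 𝟙 M' := by
  obtain ⟨hM, W, w, g, δ, hT, hW⟩ := h
  obtain ⟨hM', W', w', g', δ', hT', hW'⟩ := h'
  obtain ⟨r, hr⟩ := exists_desc_mor₂ hT g' (ht.hom_extHeart_eq_zero hW hM' _)
  obtain ⟨i, hi⟩ := exists_desc_mor₂ hT' g (ht.hom_extHeart_eq_zero hW' hM _)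
  refine ⟨i, r, sub_eq_zero.1 ?_⟩
  obtain ⟨e, he⟩ := exists_desc_mor₃ hT' (i ≫ r - 𝟙 M') (by
    rw [Preadditive.comp_sub, ← reassoc_of% hi, ← hr, Category.comp_id, sub_self])
  have hW'' : W'⟦(1 : ℤ)⟧⟦-(d : ℤ)⟧ ∈ leZeroSet P :=
    ht.iso_le _ _ (shiftComm W' (-(d : ℤ)) (1 : ℤ)) (ht.shift_le _ hW')
  rw [he, ht.hom_extHeart_eq_zero hW'' hM' e, comp_zero]

theorem statement3
    (P : Set C) (hPpre : IsPresilting P) (m : ℤ) (hm : m < 0)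
    (hP1 : ∀ X ∈ P, ∀ Y ∈ P, ∀ i : ℤ, i < m → ∀ f : X ⟶ Y⟦i⟧, f = 0)
    (hP2 : IsTStr (leZeroSet P) (geZeroSet P))
    (d : ℕ) (hd : 0 < d)
    (hPcf : ContravariantlyFinite P) :
    (∀ M ∈ extHeart P d, ∃ S ∈ intervalFrom P 0 d, IsHTrunc P d S M) ∧
    (∀ ℳ : Set C, ℳ ⊆ extHeart P d → addSet ℳ = ℳ →
        ∃ 𝒮 : Set C, IsPPresentation P d ℳ 𝒮) := by
  refine ⟨fun M hM => exists_isHTrunc hPpre hPcf d hM, fun ℳ hℳ hadd =>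
    ⟨{S | S ∈ intervalFrom P 0 d ∧ ∃ M ∈ ℳ, IsHTrunc P d S M}, fun S hS => hS.1, ?_⟩⟩
  apply Set.Subset.antisymm
  · have hsub : hTruncSet P d {S | S ∈ intervalFrom P 0 d ∧ ∃ M ∈ ℳ, IsHTrunc P d S M} ⊆ ℳ := by
      rintro M' ⟨S, ⟨_, M, hM, hSM⟩, hSM'⟩
      obtain ⟨i, r, hir⟩ := hSM.exists_retract hP2 hSM'
      rw [← hadd]
      exact .summand M' M i r hir (.of M hM)
    intro X hX
    rw [← hadd]
    exact AddClos.mono hsub hX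
  · intro M hM
    obtain ⟨S, hS, hSM⟩ := exists_isHTrunc hPpre hPcf d (hℳ hM)
    exact .of M ⟨S, ⟨hS, M, hM, hSM⟩, hSM⟩

end PaperAIR
end

section
/- Let S ∈ P^{[0,d]}. For any N ∈ d-H, there are isomorphisms Hom(H^{[−d+1,0]}(S), N[i]) ≅ Hom(S, N[i]) for all i ≤ 0, functorial in N, and a functorial injective homomorphism Hom(H^{[−d+1,0]}(S), N[1]) ↪ Hom(S, N[1]). -/
open CategoryTheory CategoryTheory.Limits CategoryTheory.Pretriangulated

universe v u

namespace PaperAIR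

variable {C : Type u} [Category.{v} C] [Preadditive C] [HasZeroObject C]
  [HasShift C ℤ] [∀ n : ℤ, (shiftFunctor C n).Additive] [Pretriangulated C]

/-- `C_𝒳^{≥ 0}` is stable under nonpositive shifts, in the form that
`X⟦b⟧ ∈ C_𝒳^{≥ 0}` follows from `X⟦a⟧ ∈ C_𝒳^{≥ 0}` when `b ≤ a`. -/
lemma shift_mem_geZeroSet_of_le {P : Set C} {X : C} {a b : ℤ} (hab : b ≤ a)
    (hX : X⟦a⟧ ∈ geZeroSet P) : X⟦b⟧ ∈ geZeroSet P := by
  intro Q hQ i hi f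
  let e : (X⟦b⟧)⟦i⟧ ≅ (X⟦a⟧)⟦b - a + i⟧ :=
    ((shiftFunctorAdd' C b i (b + i) rfl).app X).symm ≪≫
      (shiftFunctorAdd' C a (b - a + i) (b + i) (by lia)).app X
  rw [← cancel_mono e.hom, zero_comp]
  exact hX Q hQ _ (by lia) _

/-- The orthogonality of a `t`-structure, after shifting by `s`. -/
lemma IsTStr.eq_zero_of_shift {L G : Set C} (h : IsTStr L G) (s : ℤ) {X Y : C}
    (hX : X⟦s⟧ ∈ L) (hY : Y⟦s + 1⟧ ∈ G) (f : X ⟶ Y) : f = 0 := by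
  apply (shiftFunctor C s).map_injective
  rw [Functor.map_zero]
  exact h.hom_zero _ hX _ (h.iso_ge _ _ ((shiftFunctorAdd' C s 1 (s + 1) rfl).app Y) hY) _

theorem statement5
    (P : Set C) (hPpre : IsPresilting P) (m : ℤ) (hm : m < 0)
    (hP1 : ∀ X ∈ P, ∀ Y ∈ P, ∀ i : ℤ, i < m → ∀ f : X ⟶ Y⟦i⟧, f = 0)
    (hP2 : IsTStr (leZeroSet P) (geZeroSet P))
    (d : ℕ) (hd : 0 < d)
    (S : C) (hS : S ∈ intervalFrom P 0 d)
    (M : C) (hM : M ∈ extHeart P d)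
    (W : C) (w : W ⟶ S) (g : S ⟶ M) (δ : M ⟶ W⟦(1 : ℤ)⟧)
    (hT : Triangle.mk w g δ ∈ (distTriang C))
    (hW : W⟦-(d : ℤ)⟧ ∈ leZeroSet P) :
    ∀ N ∈ extHeart P d,
      (∀ i : ℤ, i ≤ 0 → Function.Bijective (fun φ : M ⟶ N⟦i⟧ => g ≫ φ)) ∧
      Function.Injective (fun φ : M ⟶ N⟦(1 : ℤ)⟧ => g ≫ φ) := by
  intro N hN
  have hNge (i s : ℤ) (hi : i + s ≤ 1 - d) : (N⟦i⟧)⟦s⟧ ∈ geZeroSet P :=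
    hP2.iso_ge _ _ ((shiftFunctorAdd' C i s (i + s) rfl).app N)
      (shift_mem_geZeroSet_of_le hi hN.2)
  have hinj (i : ℤ) (hi : i ≤ 1) :
      Function.Injective (fun φ : M ⟶ N⟦i⟧ => g ≫ φ) := by
    intro φ ψ hφψ
    obtain ⟨k, hk⟩ := Triangle.yoneda_exact₃ _ hT (φ - ψ)
      ((Preadditive.comp_sub _ _ _).trans (sub_eq_zero.mpr hφψ))
    have hk0 : k = 0 := hP2.eq_zero_of_shift (-d - 1)
      (hP2.iso_le _ _ ((shiftFunctorAdd' C (1 : ℤ) (-d - 1) (-d) (by lia)).app W) hW)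
      (hNge _ _ (by lia)) k
    rw [← sub_eq_zero, hk, hk0]
    exact comp_zero
  refine ⟨fun i hi => ⟨hinj i (by lia), fun ψ => ?_⟩, hinj 1 le_rfl⟩
  obtain ⟨φ, hφ⟩ := Triangle.yoneda_exact₂ _ hT ψ
    (hP2.eq_zero_of_shift (-d) hW (hNge _ _ (by lia)) _)
  exact ⟨φ, hφ.symm⟩

end PaperAIR
end

section
/- Let S be a (d+1)-term subcategory of K. Then S is a presilting subcategory of K if and only if add H^{[−d+1,0]}(S) ⊆ T(S). Moreover, in this case every object of add H^{[−d+1,0]}(S) is E-projective in T(S). -/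
open CategoryTheory CategoryTheory.Limits CategoryTheory.Pretriangulated

universe v u

namespace PaperAIR

variable {C : Type u} [Category.{v} C] [Preadditive C] [HasZeroObject C]
  [HasShift C ℤ] [∀ n : ℤ, (shiftFunctor C n).Additive] [Pretriangulated C]

/-- Every morphism from `X` to `Y` vanishes. -/
def HomZero (X Y : C) : Prop := ∀ f : X ⟶ Y, f = 0

lemma HomZero.of_iso_right {X Y Z : C} (h : HomZero X Y) (e : Y ≅ Z) : HomZero X Z := by
  intro f
  rw [← cancel_mono e.inv, h (f ≫ e.inv), zero_comp]

lemma HomZero.of_iso_left {X Y Z : C} (h : HomZero X Y) (e : X ≅ Z) : HomZero Z Y := by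
  intro f
  rw [← cancel_epi e.hom, h (e.hom ≫ f), comp_zero]

lemma HomZero.of_retract_right {X Y Z : C} (h : HomZero X Y) (i : Z ⟶ Y) (r : Y ⟶ Z)
    (hir : i ≫ r = 𝟙 Z) : HomZero X Z := by
  intro f
  rw [← Category.comp_id f, ← hir, ← Category.assoc, h (f ≫ i), zero_comp]

lemma HomZero.of_retract_left {X Y Z : C} (h : HomZero X Y) (i : Z ⟶ X) (r : X ⟶ Z)
    (hir : i ≫ r = 𝟙 Z) : HomZero Z Y := by
  intro f
  rw [← Category.id_comp f, ← hir, Category.assoc, h (r ≫ f), comp_zero]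

lemma HomZero.unshift {X Y : C} (n : ℤ) (h : HomZero (X⟦n⟧) (Y⟦n⟧)) : HomZero X Y := by
  intro f
  apply (shiftFunctor C n).map_injective
  rw [h ((shiftFunctor C n).map f), Functor.map_zero]

lemma HomZero.shift {X Y : C} (n : ℤ) (h : HomZero X Y) : HomZero (X⟦n⟧) (Y⟦n⟧) := by
  intro f
  obtain ⟨g, rfl⟩ := (shiftFunctor C n).map_surjective f
  rw [h g, Functor.map_zero]

lemma homZero_shift_shift_iff (X Y : C) {a b c : ℤ} (hc : a + b = c) :
    HomZero X (Y⟦a⟧⟦b⟧) ↔ HomZero X (Y⟦c⟧) :=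
  ⟨fun h => h.of_iso_right ((shiftFunctorAdd' C a b c hc).app Y).symm,
    fun h => h.of_iso_right ((shiftFunctorAdd' C a b c hc).app Y)⟩

lemma homZero_mid_left {T : Triangle C} (hT : T ∈ distTriang C) {Y : C}
    (h₁ : HomZero T.obj₁ Y) (h₃ : HomZero T.obj₃ Y) : HomZero T.obj₂ Y := by
  intro f
  obtain ⟨g, rfl⟩ := T.yoneda_exact₂ hT f (h₁ _)
  rw [h₃ g, comp_zero]

lemma homZero_mid_right {T : Triangle C} (hT : T ∈ distTriang C) {X : C} (n : ℤ)
    (h₁ : HomZero X (T.obj₁⟦n⟧)) (h₃ : HomZero X (T.obj₃⟦n⟧)) : HomZero X (T.obj₂⟦n⟧) := by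
  intro f
  obtain ⟨g, rfl⟩ := Triangle.coyoneda_exact₂ _ (Triangle.shift_distinguished T hT n) f (h₃ _)
  rw [show g = 0 from h₁ g]
  exact zero_comp

lemma homZero_third_right {T : Triangle C} (hT : T ∈ distTriang C) {X : C} {n n' : ℤ}
    (hn : 1 + n = n') (h₂ : HomZero X (T.obj₂⟦n⟧)) (h₁ : HomZero X (T.obj₁⟦n'⟧)) :
    HomZero X (T.obj₃⟦n⟧) :=
  homZero_mid_right (rot_of_distTriang T hT) n h₂ ((homZero_shift_shift_iff _ _ hn).2 h₁)

lemma shift_mem_leZeroSet_iff (P : Set C) (Y : C) (n : ℤ) :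
    Y⟦n⟧ ∈ leZeroSet P ↔ ∀ X ∈ P, ∀ i : ℤ, n < i → HomZero X (Y⟦i⟧) :=
  ⟨fun h X hX i hi => (homZero_shift_shift_iff X Y (by lia)).1 (h X hX (i - n) (by lia)),
    fun h X hX i hi => (homZero_shift_shift_iff X Y rfl).2 (h X hX (n + i) (by lia))⟩

lemma intervalFrom_homZero {P : Set C} {W : C} (n : ℕ) :
    ∀ (p : ℤ) (Z : C), Z ∈ intervalFrom P p n →
      (∀ X ∈ P, ∀ i : ℤ, -(p + n) ≤ i → HomZero X (W⟦i⟧)) → HomZero Z W := by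
  have base : ∀ (p : ℤ) (Z : C), Z ∈ shiftSet P p →
      (∀ X ∈ P, HomZero X (W⟦-p⟧)) → HomZero Z W := by
    rintro p Z ⟨X, hX, ⟨e⟩⟩ h
    refine HomZero.of_iso_left (HomZero.unshift (-p) ?_) e.symm
    exact (h X hX).of_iso_left ((shiftFunctorCompIsoId C p (-p) (by lia)).app X).symm
  induction n with
  | zero => exact fun p Z hZ h => base p Z hZ fun X hX => h X hX _ (by simp)
  | succ n ih =>
    rintro p Z ⟨A, B, hA, hB, f, g, k, hT⟩ h
    refine homZero_mid_left hT (base p A hA fun X hX => h X hX _ (by lia)) ?_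
    exact ih (p + 1) B hB fun X hX i hi => h X hX i (by push_cast; lia)

lemma intervalFrom_subset_leZeroSet {P : Set C} (hP : IsPresilting P) (n : ℕ) :
    ∀ p : ℤ, 0 ≤ p → intervalFrom P p n ⊆ leZeroSet P := by
  have base : ∀ p : ℤ, 0 ≤ p → shiftSet P p ⊆ leZeroSet P := by
    rintro p hp Z ⟨Y, hY, ⟨e⟩⟩ X hX i hi
    refine HomZero.of_iso_right ?_ ((shiftFunctor C i).mapIso e.symm)
    exact (homZero_shift_shift_iff X Y rfl).2 (hP X hX Y hY (p + i) (by lia))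
  induction n with
  | zero => exact base
  | succ n ih =>
    rintro p hp Z ⟨A, B, hA, hB, f, g, k, hT⟩ X hX i hi
    exact homZero_mid_right hT i (base p hp hA X hX i hi) (ih (p + 1) (by lia) hB X hX i hi)

lemma extHeart_iff (P : Set C) (d : ℕ) (X : C) :
    X ∈ extHeart P d ↔ (∀ Q ∈ P, ∀ i : ℤ, 0 < i → HomZero Q (X⟦i⟧)) ∧
      ∀ Q ∈ P, ∀ i : ℤ, i < 1 - d → HomZero Q (X⟦i⟧) :=
  and_congr Iff.rfl
    ⟨fun h Q hQ i hi => (homZero_shift_shift_iff Q X (by lia)).1 (h Q hQ (i - (1 - d)) (by lia)),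
      fun h Q hQ i hi => (homZero_shift_shift_iff Q X rfl).2 (h Q hQ (1 - d + i) (by lia))⟩

lemma AddClos.homZero_left {𝒮 : Set C} {Y : C} (h : ∀ X ∈ 𝒮, HomZero X Y) {M : C}
    (hM : AddClos 𝒮 M) : HomZero M Y := by
  induction hM with
  | of X hX => exact h X hX
  | zero X hX => exact fun f => hX.eq_of_src f 0
  | biprod X Y Z i₁ i₂ p₁ p₂ h₁ h₂ h₁₂ h₂₁ htot hX hY ihX ihY =>
    intro f
    rw [← Category.id_comp f, ← htot, Preadditive.add_comp, Category.assoc, Category.assoc,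
      ihX (i₁ ≫ f), ihY (i₂ ≫ f), comp_zero, comp_zero, add_zero]
  | summand X Y i r hir hY ihY => exact ihY.of_retract_left i r hir

lemma AddClos.homZero_right {𝒮 : Set C} {A : C} {n : ℤ} (h : ∀ X ∈ 𝒮, HomZero A (X⟦n⟧)) {M : C}
    (hM : AddClos 𝒮 M) : HomZero A (M⟦n⟧) := by
  induction hM with
  | of X hX => exact h X hX
  | zero X hX => exact fun f => ((shiftFunctor C n).map_isZero hX).eq_of_tgt f 0
  | biprod X Y Z i₁ i₂ p₁ p₂ h₁ h₂ h₁₂ h₂₁ htot hX hY ihX ihY =>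
    intro f
    rw [← Category.comp_id f, ← CategoryTheory.Functor.map_id, ← htot, Functor.map_add,
      Functor.map_comp,
      Functor.map_comp, Preadditive.comp_add, ← Category.assoc, ← Category.assoc,
      ihX (f ≫ (shiftFunctor C n).map p₁), ihY (f ≫ (shiftFunctor C n).map p₂),
      zero_comp, zero_comp, add_zero]
  | summand X Y i r hir hY ihY =>
    exact ihY.of_retract_right ((shiftFunctor C n).map i) ((shiftFunctor C n).map r)
      (by rw [← Functor.map_comp, hir, CategoryTheory.Functor.map_id])

lemma addSet_subset_TClass {P 𝒮 𝒳 : Set C} {d : ℕ} (h : 𝒳 ⊆ TClass P d 𝒮) :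
    addSet 𝒳 ⊆ TClass P d 𝒮 := by
  intro M hM
  refine ⟨(extHeart_iff P d M).2 ⟨fun Q hQ i hi => ?_, fun Q hQ i hi => ?_⟩, fun A hA i hi => ?_⟩
  · exact hM.homZero_right fun X hX => (h hX).1.1 Q hQ i hi
  · exact hM.homZero_right fun X hX => ((extHeart_iff P d X).1 (h hX).1).2 Q hQ i hi
  · exact hM.homZero_right fun X hX => (h hX).2 A hA i hi

lemma mk_distinguished_of_iso_mid {T : Triangle C} (hT : T ∈ distTriang C) {X : C}
    (e : T.obj₂ ≅ X) : Triangle.mk (T.mor₁ ≫ e.hom) (e.inv ≫ T.mor₂) T.mor₃ ∈ distTriang C :=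
  isomorphic_distinguished _ hT _
    (Triangle.isoMk _ T (Iso.refl T.obj₁) e.symm (Iso.refl T.obj₃)
      (((Iso.comp_inv_eq e).2 rfl).trans (Category.id_comp T.mor₁).symm)
      (Category.comp_id (e.inv ≫ T.mor₂))
      (((congrArg (T.mor₃ ≫ ·) ((shiftFunctor C (1 : ℤ)).map_id T.obj₁)).trans
        (Category.comp_id T.mor₃)).trans (Category.id_comp T.mor₃).symm))

lemma exists_isHTrunc_s6 {P : Set C} (hP : IsTStr (leZeroSet P) (geZeroSet P)) (d : ℕ) {X : C}
    (hX : X ∈ leZeroSet P) : ∃ M, IsHTrunc P d X M := by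
  obtain ⟨A, B, f, g, k, hT, hA, hB⟩ := hP.exists_tri (X⟦-(d : ℤ)⟧)
  have hT' := Triangle.shift_distinguished _ hT (d : ℤ)
  let e : (X⟦-(d : ℤ)⟧)⟦(d : ℤ)⟧ ≅ X := (shiftFunctorCompIsoId C (-(d : ℤ)) d (by lia)).app X
  have hT₃ := mk_distinguished_of_iso_mid hT' e
  have hW : (A⟦(d : ℤ)⟧)⟦-(d : ℤ)⟧ ∈ leZeroSet P :=
    hP.iso_le _ _ ((shiftFunctorCompIsoId C (d : ℤ) (-d) (by lia)).app A).symm hA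
  refine ⟨B⟦(d : ℤ)⟧, ⟨fun Q hQ i hi => ?_, ?_⟩, _, _, _, _, hT₃, hW⟩
  · exact homZero_third_right hT₃ rfl (hX Q hQ i hi)
      ((shift_mem_leZeroSet_iff P _ _).1 hW Q hQ (1 + i) (by lia))
  · exact hP.iso_ge _ _ ((shiftFunctorAdd' C (d : ℤ) (1 - d) 1 (by lia)).app B) hB

theorem statement6
    (P : Set C) (hPpre : IsPresilting P) (m : ℤ) (hm : m < 0)
    (hP1 : ∀ X ∈ P, ∀ Y ∈ P, ∀ i : ℤ, i < m → ∀ f : X ⟶ Y⟦i⟧, f = 0)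
    (hP2 : IsTStr (leZeroSet P) (geZeroSet P))
    (d : ℕ) (hd : 0 < d)
    (S : Set C) (hterm : S ⊆ intervalFrom P 0 d) :
    (IsPresilting S ↔ addSet (hTruncSet P d S) ⊆ TClass P d S) ∧
    (IsPresilting S →
      ∀ M ∈ addSet (hTruncSet P d S), ∀ X ∈ TClass P d S, ∀ f : M ⟶ X⟦(1 : ℤ)⟧, f = 0) := by
  have hS {A W : C} (hA : A ∈ S) (hW : W⟦-(d : ℤ)⟧ ∈ leZeroSet P) {i : ℤ} (hi : 0 < i) :
      HomZero A (W⟦i⟧) :=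
    intervalFrom_homZero d 0 A (hterm hA) fun X hX j hj =>
      (homZero_shift_shift_iff X W rfl).2
        ((shift_mem_leZeroSet_iff P W _).1 hW X hX (i + j) (by lia))
  refine ⟨⟨fun hpre => addSet_subset_TClass ?_, fun hT A hA B hB i hi => ?_⟩, ?_⟩
  · rintro M ⟨B, hB, hM, W, f, g, k, hT, hW⟩
    exact ⟨hM, fun A hA i hi =>
      homZero_third_right hT rfl (hpre A hA B hB i hi) (hS hA hW (by lia))⟩
  · obtain ⟨M, hM⟩ :=
      exists_isHTrunc_s6 hP2 d (intervalFrom_subset_leZeroSet hPpre d 0 le_rfl (hterm hB))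
    have hMT := (hT (AddClos.of M ⟨B, hB, hM⟩)).2 A hA i hi
    obtain ⟨-, W, f, g, k, hTri, hW⟩ := hM
    exact homZero_mid_right hTri i (hS hA hW hi) hMT
  · intro _ M hM X hX
    refine AddClos.homZero_left ?_ hM
    rintro N ⟨B, hB, hN, W, f, g, k, hTri, hW⟩
    refine homZero_mid_left (rot_of_distTriang _ hTri) (hX.2 B hB 1 one_pos) ?_
    refine HomZero.shift 1 (HomZero.unshift (-(d : ℤ)) fun φ => ?_)
    refine hP2.hom_zero _ hW _ (hP2.iso_ge _ _ ?_ hX.1.2) φ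
    exact (shiftFunctorAdd' C (-(d : ℤ)) 1 (1 - d) (by lia)).app X

end PaperAIR
end

section
/- For any AIR tilting subcategory M of d-H, the pair (Fac_d(M), M^{⊥≤0}) is an s-torsion pair in d-H, where M^{⊥≤0} := {N ∈ d-H : Hom(M, N[i]) = 0 for all M ∈ M, i ≤ 0}; moreover, the map M ↦ (Fac_d(M), M^{⊥≤0}) from the set of AIR tilting subcategories of d-H to the set of s-torsion pairs in d-H is injective. -/
open CategoryTheory CategoryTheory.Limits CategoryTheory.Pretriangulated

universe v u

namespace PaperAIR

variable {C : Type u} [Category.{v} C] [Preadditive C] [HasZeroObject C]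
  [HasShift C ℤ] [∀ n : ℤ, (shiftFunctor C n).Additive] [Pretriangulated C]

set_option linter.unusedSectionVars false

/-- `Hom(A, Y[i]) = 0`. -/
def HomVanish (A Y : C) (i : ℤ) : Prop := ∀ f : A ⟶ Y⟦i⟧, f = 0

/-- `Y ∈ D^{≤ n}`. -/
def TLe (P : Set C) (n : ℤ) (Y : C) : Prop := ∀ p ∈ P, ∀ i : ℤ, n < i → HomVanish p Y i

/-- `Y ∈ D^{≥ n}`. -/
def TGe (P : Set C) (n : ℤ) (Y : C) : Prop := ∀ p ∈ P, ∀ i : ℤ, i < n → HomVanish p Y i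

namespace HomVanish

lemma of_iso_tgt {A Y Y' : C} (e : Y ≅ Y') {i : ℤ} (h : HomVanish A Y i) : HomVanish A Y' i := by
  intro f
  have h0 := h (f ≫ e.inv⟦i⟧')
  have : f = (f ≫ e.inv⟦i⟧') ≫ e.hom⟦i⟧' := by
    rw [Category.assoc, ← Functor.map_comp, e.inv_hom_id, CategoryTheory.Functor.map_id,
      Category.comp_id]
  rw [this, h0, zero_comp]

lemma of_iso_src {A A' Y : C} (e : A ≅ A') {i : ℤ} (h : HomVanish A Y i) : HomVanish A' Y i := by
  intro f
  rw [← cancel_epi e.hom, h (e.hom ≫ f), comp_zero]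

lemma zero_iff {A Y : C} : HomVanish A Y 0 ↔ ∀ f : A ⟶ Y, f = 0 := by
  constructor
  · intro h f
    rw [← cancel_mono ((shiftFunctorZero C ℤ).inv.app Y), zero_comp]
    exact h _
  · intro h f
    rw [← cancel_mono ((shiftFunctorZero C ℤ).hom.app Y), zero_comp]
    exact h _

lemma shift_tgt_iff {A Y : C} {k i n : ℤ} (hn : k + i = n) :
    HomVanish A (Y⟦k⟧) i ↔ HomVanish A Y n := by
  constructor
  · intro h f
    rw [← cancel_mono ((shiftFunctorAdd' C k i n hn).hom.app Y), zero_comp]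
    exact h _
  · intro h f
    rw [← cancel_mono ((shiftFunctorAdd' C k i n hn).inv.app Y), zero_comp]
    exact h _

lemma shift_src_iff {A Y : C} {k i n : ℤ} (hn : n + k = i) :
    HomVanish (A⟦k⟧) Y i ↔ HomVanish A Y n := by
  constructor
  · intro h f
    apply (shiftFunctor C k).map_injective
    rw [Functor.map_zero, ← cancel_mono ((shiftFunctorAdd' C n k i hn).inv.app Y), zero_comp]
    exact h _
  · intro h f
    rw [← cancel_mono ((shiftFunctorAdd' C n k i hn).hom.app Y), zero_comp]
    obtain ⟨g, hg⟩ := (shiftFunctor C k).map_surjective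
      (f ≫ (shiftFunctorAdd' C n k i hn).hom.app Y)
    rw [← hg, h g, Functor.map_zero]

end HomVanish

section LongExact

variable {X Y Z : C} {f : X ⟶ Y} {g : Y ⟶ Z} {h : Z ⟶ X⟦(1 : ℤ)⟧}

lemma exists_factor₂ (hT : Triangle.mk f g h ∈ distTriang C) {B : C} (a : Y ⟶ B)
    (ha : f ≫ a = 0) : ∃ b : Z ⟶ B, a = g ≫ b :=
  Triangle.yoneda_exact₂ _ hT a ha

lemma exists_factor₃ (hT : Triangle.mk f g h ∈ distTriang C) {B : C} (a : Z ⟶ B)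
    (ha : g ≫ a = 0) : ∃ b : X⟦(1 : ℤ)⟧ ⟶ B, a = h ≫ b :=
  Triangle.yoneda_exact₃ _ hT a ha

lemma exists_lift₃ (hT : Triangle.mk f g h ∈ distTriang C) {A : C} (a : A ⟶ Z)
    (ha : a ≫ h = 0) : ∃ b : A ⟶ Y, a = b ≫ g :=
  Triangle.coyoneda_exact₃ _ hT a ha

lemma exists_lift₁ (hT : Triangle.mk f g h ∈ distTriang C) {A : C} (a : A ⟶ X⟦(1 : ℤ)⟧)
    (ha : a ≫ f⟦1⟧' = 0) : ∃ b : A ⟶ Z, a = b ≫ h :=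
  Triangle.coyoneda_exact₁ _ hT a ha

lemma rotate_mem (hT : Triangle.mk f g h ∈ distTriang C) :
    Triangle.mk g h (-f⟦(1 : ℤ)⟧') ∈ distTriang C :=
  rot_of_distTriang _ hT

lemma exists_lift_shift₂ (hT : Triangle.mk f g h ∈ distTriang C) {A : C} {i : ℤ}
    (a : A ⟶ Y⟦i⟧) (ha : a ≫ g⟦i⟧' = 0) : ∃ b : A ⟶ X⟦i⟧, a = b ≫ f⟦i⟧' := by
  have H : ∃ b : A ⟶ X⟦i⟧, a = b ≫ (i.negOnePow • f⟦i⟧') := by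
    refine Triangle.coyoneda_exact₂ _ (Triangle.shift_distinguished _ hT i) a ?_
    change a ≫ (i.negOnePow • g⟦i⟧') = 0
    rw [Linear.comp_units_smul, ha, smul_zero]
  obtain ⟨b, hb⟩ := H
  exact ⟨i.negOnePow • b, by rw [hb, Linear.comp_units_smul, Linear.units_smul_comp]⟩

lemma exists_lift_shift₃ (hT : Triangle.mk f g h ∈ distTriang C) {A : C} {i : ℤ}
    (hA : HomVanish A X (i + 1)) (a : A ⟶ Z⟦i⟧) : ∃ b : A ⟶ Y⟦i⟧, a = b ≫ g⟦i⟧' :=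
  exists_lift_shift₂ (rotate_mem hT) a
    ((HomVanish.shift_tgt_iff (add_comm 1 i)).2 hA _)

lemma map_shift_injective (hT : Triangle.mk f g h ∈ distTriang C) {A : C} {i : ℤ}
    (hA : HomVanish A X i) (a : A ⟶ Y⟦i⟧) (ha : a ≫ g⟦i⟧' = 0) : a = 0 := by
  obtain ⟨b, hb⟩ := exists_lift_shift₂ hT a ha
  rw [hb, hA b, zero_comp]

lemma HomVanish.tgt₂ (hT : Triangle.mk f g h ∈ distTriang C) {A : C} {i : ℤ}
    (h₁ : HomVanish A X i) (h₃ : HomVanish A Z i) : HomVanish A Y i :=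
  fun a => map_shift_injective hT h₁ a (h₃ _)

lemma HomVanish.tgt₃ (hT : Triangle.mk f g h ∈ distTriang C) {A : C} {i : ℤ}
    (h₂ : HomVanish A Y i) (h₁ : HomVanish A X (i + 1)) : HomVanish A Z i := by
  intro a
  obtain ⟨b, hb⟩ := exists_lift_shift₃ hT h₁ a
  rw [hb, h₂ b, zero_comp]

lemma HomVanish.tgt₁ (hT : Triangle.mk f g h ∈ distTriang C) {A : C} {i : ℤ}
    (h₂ : ∀ a : A ⟶ Y⟦i⟧, a ≫ g⟦i⟧' = 0 → a = 0)
    (h₃ : ∀ a : A ⟶ Z⟦i - 1⟧, ∃ b : A ⟶ Y⟦i - 1⟧, a = b ≫ g⟦i - 1⟧') : HomVanish A X i := by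
  have hfg : f ≫ g = 0 := comp_distTriang_mor_zero₁₂ _ hT
  have hf (k : A ⟶ X⟦i⟧) : k ≫ f⟦i⟧' = 0 :=
    h₂ _ (by rw [Category.assoc, ← Functor.map_comp, hfg, Functor.map_zero, comp_zero])
  suffices H : HomVanish A (X⟦(1 : ℤ)⟧) (i - 1) from
    (HomVanish.shift_tgt_iff (by ring)).1 H
  intro a
  have ha : a ≫ (f⟦(1 : ℤ)⟧')⟦i - 1⟧' = 0 := by
    let e := shiftFunctorAdd' C 1 (i - 1) i (by ring)
    have hn := e.inv.naturality f
    have h0 := hf (a ≫ e.inv.app X)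
    rw [Category.assoc, ← hn, ← Category.assoc] at h0
    exact (cancel_mono (e.inv.app Y)).1 (h0.trans zero_comp.symm)
  obtain ⟨b, hb⟩ := exists_lift_shift₂ (rotate_mem (rotate_mem hT)) a (by
    rw [Functor.map_neg, Preadditive.comp_neg, ha, neg_zero])
  obtain ⟨c, hc⟩ := h₃ b
  have hz : g ≫ h = 0 := comp_distTriang_mor_zero₂₃ _ hT
  rw [hb, hc, Category.assoc, ← Functor.map_comp, hz, Functor.map_zero, comp_zero]

lemma HomVanish.src₂ (hT : Triangle.mk f g h ∈ distTriang C) {B : C} {i : ℤ}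
    (h₁ : HomVanish X B i) (h₃ : HomVanish Z B i) : HomVanish Y B i := by
  intro a
  obtain ⟨b, hb⟩ := exists_factor₂ hT a (h₁ _)
  rw [hb, h₃ b, comp_zero]

lemma HomVanish.src₃ (hT : Triangle.mk f g h ∈ distTriang C) {B : C} {i : ℤ}
    (h₂ : HomVanish Y B i) (h₁ : HomVanish X B (i - 1)) : HomVanish Z B i :=
  HomVanish.src₂ (rotate_mem hT) h₂ ((HomVanish.shift_src_iff (by ring)).2 h₁)

end LongExact

lemma AddClos.homVanish_src {𝒮 : Set C} {Y : C} {i : ℤ} (h : ∀ X ∈ 𝒮, HomVanish X Y i)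
    {X : C} (hX : AddClos 𝒮 X) : HomVanish X Y i := by
  induction hX with
  | of X hX => exact h X hX
  | zero X hX => exact fun f => hX.eq_of_src _ _
  | biprod X Y Z i₁ i₂ p₁ p₂ _ _ _ _ htot _ _ hX hY =>
    intro f
    rw [← Category.id_comp f, ← htot, Preadditive.add_comp, Category.assoc, Category.assoc,
      hX (i₁ ≫ f), hY (i₂ ≫ f)]
    simp
  | summand X Y i r hir _ hY =>
    intro f
    rw [← Category.id_comp f, ← hir, Category.assoc, hY (r ≫ f), comp_zero]

lemma AddClos.homVanish_tgt {𝒮 : Set C} {A : C} {i : ℤ} (h : ∀ X ∈ 𝒮, HomVanish A X i)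
    {X : C} (hX : AddClos 𝒮 X) : HomVanish A X i := by
  induction hX with
  | of X hX => exact h X hX
  | zero X hX => exact fun f => ((shiftFunctor C i).map_isZero hX).eq_of_tgt _ _
  | biprod X Y Z i₁ i₂ p₁ p₂ _ _ _ _ htot _ _ hX hY =>
    intro f
    rw [← Category.comp_id f, ← CategoryTheory.Functor.map_id, ← htot, Functor.map_add, Functor.map_comp,
      Functor.map_comp, Preadditive.comp_add, ← Category.assoc, ← Category.assoc,
      hX (f ≫ p₁⟦_⟧'), hY (f ≫ p₂⟦_⟧')]
    simp
  | summand X Y i r hir _ hY =>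
    intro f
    rw [← Category.comp_id f, ← CategoryTheory.Functor.map_id, ← hir, Functor.map_comp, ← Category.assoc,
      hY (f ≫ i⟦_⟧'), zero_comp]

lemma AddClos.exists_factor {𝒮 : Set C} {M T : C} (b : M ⟶ T)
    (h : ∀ X ∈ 𝒮, ∀ f : X ⟶ T, ∃ k, k ≫ b = f) {X : C} (hX : AddClos 𝒮 X) :
    ∀ f : X ⟶ T, ∃ k, k ≫ b = f := by
  induction hX with
  | of X hX => exact h X hX
  | zero X hX => exact fun f => ⟨0, hX.eq_of_src _ _⟩
  | biprod X Y Z i₁ i₂ p₁ p₂ _ _ _ _ htot _ _ hX hY =>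
    intro f
    obtain ⟨k, hk⟩ := hX (i₁ ≫ f)
    obtain ⟨l, hl⟩ := hY (i₂ ≫ f)
    refine ⟨p₁ ≫ k + p₂ ≫ l, ?_⟩
    rw [Preadditive.add_comp, Category.assoc, Category.assoc, hk, hl, ← Category.assoc,
      ← Category.assoc, ← Preadditive.add_comp, htot, Category.id_comp]
  | summand X Y i r hir _ hY =>
    intro f
    obtain ⟨k, hk⟩ := hY (r ≫ f)
    exact ⟨i ≫ k, by rw [Category.assoc, hk, ← Category.assoc, hir, Category.id_comp]⟩

section TStructure

variable {P : Set C} {d : ℕ}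

lemma TLe.shift_iff {n n' k : ℤ} (h : n + k = n') {Y : C} : TLe P n (Y⟦k⟧) ↔ TLe P n' Y :=
  ⟨fun hY p hp i hi => (HomVanish.shift_tgt_iff (by ring)).1 (hY p hp (i - k) (by omega)),
    fun hY p hp i hi => (HomVanish.shift_tgt_iff rfl).2 (hY p hp (k + i) (by omega))⟩

lemma TGe.shift_iff {n n' k : ℤ} (h : n + k = n') {Y : C} : TGe P n (Y⟦k⟧) ↔ TGe P n' Y :=
  ⟨fun hY p hp i hi => (HomVanish.shift_tgt_iff (by ring)).1 (hY p hp (i - k) (by omega)),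
    fun hY p hp i hi => (HomVanish.shift_tgt_iff rfl).2 (hY p hp (k + i) (by omega))⟩

lemma mem_extHeart_iff {X : C} : X ∈ extHeart P d ↔ TLe P 0 X ∧ TGe P (1 - d) X :=
  and_congr Iff.rfl (TGe.shift_iff (n := 0) (by ring))

lemma isHTrunc_iff {S M : C} : IsHTrunc P d S M ↔ M ∈ extHeart P d ∧
    ∃ (W : C) (f : W ⟶ S) (g : S ⟶ M) (h : M ⟶ W⟦(1 : ℤ)⟧),
      Triangle.mk f g h ∈ (distTriang C) ∧ TLe P (-d) W := by
  have H (W : C) : W⟦-(d : ℤ)⟧ ∈ leZeroSet P ↔ TLe P (-d) W :=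
    TLe.shift_iff (n := 0) (by ring)
  simp only [IsHTrunc, H]

lemma homVanish_of_tStr (ht : IsTStr (leZeroSet P) (geZeroSet P)) {X Y : C} {a b i : ℤ}
    (hX : TLe P a X) (hY : TGe P b Y) (h : i + a < b) : HomVanish X Y i := by
  intro f
  apply (shiftFunctor C a).map_injective
  rw [Functor.map_zero]
  refine ht.hom_zero _ ((TLe.shift_iff (n := 0) (by ring)).2 hX) _ ?_ _
  have : TGe P 0 (Y⟦i⟧⟦a⟧⟦(1 : ℤ)⟧) := by
    rw [TGe.shift_iff rfl, TGe.shift_iff rfl, TGe.shift_iff rfl]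
    exact fun p hp j hj => hY p hp j (by omega)
  exact this

lemma exists_truncation (ht : IsTStr (leZeroSet P) (geZeroSet P)) {Y : C} (hY : TLe P 0 Y) :
    ∃ M : C, IsHTrunc P d Y M := by
  obtain ⟨A, B, f, g, h, hT, hA, hB⟩ := ht.exists_tri (Y⟦-(d : ℤ)⟧)
  have hA : TLe P 0 A := hA
  have hB : TGe P 0 (B⟦(1 : ℤ)⟧) := hB
  obtain ⟨f', g', h', hT'⟩ : ∃ (f' : A⟦(d : ℤ)⟧ ⟶ Y) (g' : Y ⟶ B⟦(d : ℤ)⟧)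
      (h' : B⟦(d : ℤ)⟧ ⟶ A⟦(d : ℤ)⟧⟦(1 : ℤ)⟧), Triangle.mk f' g' h' ∈ distTriang C := by
    let T := (Triangle.shiftFunctor C (d : ℤ)).obj (Triangle.mk f g h)
    let e : T.obj₂ ≅ Y := (shiftFunctorCompIsoId C (-(d : ℤ)) d (by ring)).app Y
    refine ⟨T.mor₁ ≫ e.hom, e.inv ≫ T.mor₂, T.mor₃, ?_⟩
    refine isomorphic_distinguished T (Triangle.shift_distinguished _ hT d) _ ?_
    refine Triangle.isoMk _ _ (Iso.refl _) e.symm (Iso.refl _) ?_ ?_ ?_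
    · change (T.mor₁ ≫ e.hom) ≫ e.inv = 𝟙 _ ≫ T.mor₁
      rw [Category.assoc, e.hom_inv_id, Category.comp_id, Category.id_comp]
    · exact Category.comp_id _
    · change T.mor₃ ≫ (𝟙 T.obj₁)⟦(1 : ℤ)⟧' = 𝟙 T.obj₃ ≫ T.mor₃
      rw [CategoryTheory.Functor.map_id, Category.comp_id, Category.id_comp]
  have hW : TLe P (-d) (A⟦(d : ℤ)⟧) := (TLe.shift_iff (by ring)).2 hA
  refine ⟨B⟦(d : ℤ)⟧, isHTrunc_iff.2 ⟨mem_extHeart_iff.2 ⟨?_, ?_⟩, _, _, _, _, hT', hW⟩⟩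
  · exact fun p hp i hi => HomVanish.tgt₃ hT' (hY p hp i hi) (hW p hp _ (by omega))
  · rw [TGe.shift_iff rfl] at hB ⊢
    convert hB using 1
    ring

lemma homVanish_of_mem_intervalFrom {Y : C} {a : ℤ} (hY : TLe P a Y) {n : ℕ} :
    ∀ {q : ℤ} {A : C}, A ∈ intervalFrom P q n → ∀ {i : ℤ}, a + q + n < i → HomVanish A Y i := by
  have base {q : ℤ} {A : C} (hA : A ∈ shiftSet P q) {i : ℤ} (hi : a + q < i) :
      HomVanish A Y i := by
    obtain ⟨p, hp, ⟨e⟩⟩ := hA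
    exact HomVanish.of_iso_src e.symm
      ((HomVanish.shift_src_iff (sub_add_cancel i q)).2 (hY p hp _ (by omega)))
  induction n with
  | zero => exact fun hA i hi => base hA (by simpa using hi)
  | succ n ih =>
    rintro q A ⟨A₁, A₂, h₁, h₂, f, g, h, hT⟩ i hi
    exact HomVanish.src₂ hT (base h₁ (by omega)) (ih h₂ (by push_cast at hi; omega))

lemma tLe_of_mem_intervalFrom (hP : IsPresilting P) {n : ℕ} :
    ∀ {q : ℤ} {A : C}, 0 ≤ q → A ∈ intervalFrom P q n → TLe P 0 A := by
  have base {q : ℤ} (hq : 0 ≤ q) {A : C} (hA : A ∈ shiftSet P q) : TLe P 0 A := by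
    obtain ⟨p, hp, ⟨e⟩⟩ := hA
    exact fun p' hp' i hi => HomVanish.of_iso_tgt e.symm
      ((HomVanish.shift_tgt_iff rfl).2 (hP p' hp' p hp _ (by omega)))
  induction n with
  | zero => exact fun hq hA => base hq hA
  | succ n ih =>
    rintro q A hq ⟨A₁, A₂, h₁, h₂, f, g, h, hT⟩ p hp i hi
    exact HomVanish.tgt₂ hT (base hq h₁ p hp i hi) (ih (by omega) h₂ p hp i hi)

end TStructure

/-- Iterated right approximations by `𝒮, 𝒮[1], …, 𝒮[N-1]` of an object. -/
lemma exists_iterated_approx {𝒮 : Set C} (hS : IsPresilting 𝒮) (hc : ContravariantlyFinite 𝒮)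
    (X : C) (N : ℕ) : ∃ (Z : C) (u : X ⟶ Z),
      (∀ (R : C) (i : ℤ), (∀ A ∈ 𝒮, ∀ j : ℤ, 0 ≤ j → j < N → HomVanish A R (i - j)) →
        ∀ f : X ⟶ R⟦i⟧, ∃ g : Z ⟶ R⟦i⟧, f = u ≫ g) ∧
      (∀ A ∈ 𝒮, ∀ j : ℤ, 0 ≤ j → j < N → HomVanish A Z (-j)) ∧
      (∀ A : C, (∀ S ∈ 𝒮, ∀ k : ℤ, 0 < k → HomVanish A S k) → ∀ i : ℤ,
        (0 < i → ∀ a : A ⟶ X⟦i⟧, a ≫ u⟦i⟧' = 0 → a = 0) ∧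
        (0 ≤ i → ∀ a : A ⟶ Z⟦i⟧, ∃ b : A ⟶ X⟦i⟧, a = b ≫ u⟦i⟧')) := by
  induction N with
  | zero =>
    refine ⟨X, 𝟙 X, fun R i _ f => ⟨f, by simp⟩, fun A _ j h0 h1 => ?_, fun A _ i => ⟨?_, ?_⟩⟩
    · simp at h1
      omega
    · intro _ a ha
      simpa using ha
    · exact fun _ a => ⟨a, by simp⟩
  | succ N ih =>
    obtain ⟨Z, u, h1, h2, h3⟩ := ih
    obtain ⟨S, a, hSmem, happ⟩ := hc (Z⟦-(N : ℤ)⟧)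
    let adj : shiftFunctor C (N : ℤ) ⊣ shiftFunctor C (-(N : ℤ)) := (shiftEquiv C (N : ℤ)).toAdjunction
    let a' : S⟦(N : ℤ)⟧ ⟶ Z := (adj.homEquiv S Z).symm a
    obtain ⟨Z', v, w, hT⟩ := distinguished_cocone_triangle a'
    have hav : a ≫ v⟦-(N : ℤ)⟧' = 0 := by
      have hz : a' ≫ v = 0 := comp_distTriang_mor_zero₁₂ _ hT
      have h := adj.homEquiv_naturality_right a' v
      rw [(adj.homEquiv S Z).apply_symm_apply a] at h
      rw [← h, hz, adj.homEquiv_unit, Functor.map_zero, comp_zero]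
    have hvan {A : C} (hA : ∀ S ∈ 𝒮, ∀ k : ℤ, 0 < k → HomVanish A S k) {i : ℤ}
        (hi : 0 < i + N) : HomVanish A (S⟦(N : ℤ)⟧) i :=
      (HomVanish.shift_tgt_iff rfl).2 (hA S hSmem _ (by omega))
    refine ⟨Z', u ≫ v, ?_, ?_, ?_⟩
    · intro R i hR f
      obtain ⟨g, rfl⟩ := h1 R i (fun A hA j hj0 hj => hR A hA j hj0 (by push_cast; omega)) f
      have hSR : HomVanish (S⟦(N : ℤ)⟧) R i :=
        (HomVanish.shift_src_iff (sub_add_cancel i _)).2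
          (hR S hSmem N (by omega) (by push_cast; omega))
      obtain ⟨k, rfl⟩ := exists_factor₂ hT g (hSR _)
      exact ⟨k, (Category.assoc _ _ _).symm⟩
    · intro A hA j hj0 hj
      have hSA := hvan (hS A hA) (i := -j + 1) (by push_cast at hj; omega)
      rcases lt_or_eq_of_le (show j ≤ N by push_cast at hj; omega) with hj' | rfl
      · exact HomVanish.tgt₃ hT (h2 A hA j hj0 hj') hSA
      · intro f
        obtain ⟨b, rfl⟩ := exists_lift_shift₃ hT hSA f
        obtain ⟨k, rfl⟩ := happ A hA b
        rw [Category.assoc, hav, comp_zero]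
    · intro A hA i
      constructor
      · intro hi b hb
        refine (h3 A hA i).1 hi b (map_shift_injective hT (hvan hA (by omega)) _ ?_)
        rwa [Category.assoc, ← Functor.map_comp]
      · intro hi b
        obtain ⟨b', rfl⟩ := exists_lift_shift₃ hT (hvan hA (by omega)) b
        obtain ⟨c, rfl⟩ := (h3 A hA i).2 hi b'
        exact ⟨c, by rw [Functor.map_comp, Category.assoc]⟩

section AIRTilting

variable {P : Set C} {d : ℕ} {ℳ 𝒮 : Set C}

lemma zero_mem_Fac (h0 : ∀ Z : C, IsZero Z → Z ∈ ℳ) {Z : C} (hZ : IsZero Z) (s : ℕ) :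
    Z ∈ Fac P d ℳ s := by
  have hv (A : C) (i : ℤ) : HomVanish A Z i :=
    fun f => ((shiftFunctor C i).map_isZero hZ).eq_of_tgt _ _
  have hZH : Z ∈ extHeart P d :=
    mem_extHeart_iff.2 ⟨fun p _ i _ => hv p i, fun p _ i _ => hv p i⟩
  induction s with
  | zero => exact hZH
  | succ s ih =>
    refine ⟨Z, ih, Z, h0 Z hZ, hZH, hZH, hZH, 0, 𝟙 Z, 0, ?_⟩
    exact isomorphic_distinguished _ (contractible_distinguished₁ Z) _
      (Triangle.isoMk _ _ (hZ.iso (isZero_zero C)) (Iso.refl _) (Iso.refl _)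
        (hZ.eq_of_src _ _) rfl (hZ.eq_of_src _ _))

lemma subset_Fac (h0 : ∀ Z : C, IsZero Z → Z ∈ ℳ) (hℳ : ℳ ⊆ extHeart P d) (s : ℕ) :
    ℳ ⊆ Fac P d ℳ s := by
  intro M hM
  cases s with
  | zero => exact hℳ hM
  | succ s =>
    have hZ := zero_mem_Fac (P := P) (d := d) h0 (isZero_zero C) s
    have hZ' := zero_mem_Fac (P := P) (d := d) h0 (isZero_zero C) 0
    exact ⟨_, hZ, M, hM, hZ', hℳ hM, hℳ hM, 0, 𝟙 M, 0, contractible_distinguished₁ M⟩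

lemma Fac_homVanish (ht : IsTStr (leZeroSet P) (geZeroSet P)) {F : C} (hF : F ∈ extHeart P d)
    (hMF : ∀ M ∈ ℳ, ∀ i : ℤ, i ≤ 0 → HomVanish M F i) (s : ℕ) :
    ∀ T ∈ Fac P d ℳ s, ∀ i : ℤ, i ≤ 0 → i < 1 - d + s → HomVanish T F i := by
  induction s with
  | zero =>
    intro T hT i _ hi
    exact homVanish_of_tStr ht (mem_extHeart_iff.1 hT).1 (mem_extHeart_iff.1 hF).2
      (by simpa using hi)
  | succ s ih =>
    rintro T ⟨Z, hZ, B, hB, -, -, -, f, g, h, hT⟩ i hi0 hi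
    exact HomVanish.src₃ hT (hMF B hB i hi0)
      (ih Z hZ _ (by omega) (by push_cast at hi; omega))

namespace IsAIRTiltingWrt

section

variable (hM : IsAIRTiltingWrt P d ℳ 𝒮)
include hM

lemma zero_mem {Z : C} (hZ : IsZero Z) : Z ∈ ℳ := by
  rw [← hM.1.2]
  exact AddClos.zero Z hZ

lemma subset_extHeart : ℳ ⊆ extHeart P d := by
  intro M hMM
  rw [← hM.1.2] at hMM
  refine mem_extHeart_iff.2 ⟨fun p hp i hi => ?_, fun p hp i hi => ?_⟩
  · refine AddClos.homVanish_tgt (fun X hX => ?_) hMM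
    obtain ⟨S, -, hX⟩ := hX
    exact (mem_extHeart_iff.1 hX.1).1 p hp i hi
  · refine AddClos.homVanish_tgt (fun X hX => ?_) hMM
    obtain ⟨S, -, hX⟩ := hX
    exact (mem_extHeart_iff.1 hX.1).2 p hp i hi

lemma hTrunc_mem {S M : C} (hS : S ∈ 𝒮) (h : IsHTrunc P d S M) : M ∈ ℳ := by
  rw [← hM.1.2]
  exact AddClos.of M ⟨S, hS, h⟩

lemma subset_TClass : ℳ ⊆ TClass P d 𝒮 := by
  rw [hM.2.2]
  exact subset_Fac (fun _ => hM.zero_mem) hM.subset_extHeart d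

lemma homVanish_of_tLe {A Y : C} (hA : A ∈ 𝒮) {a i : ℤ} (hY : TLe P a Y) (hi : a + d < i) :
    HomVanish A Y i :=
  homVanish_of_mem_intervalFrom hY (hM.1.1 hA) (by simpa using hi)

end

variable (hP : IsPresilting P) (ht : IsTStr (leZeroSet P) (geZeroSet P))

include ht in
lemma homVanish_src (hM : IsAIRTiltingWrt P d ℳ 𝒮) {X : C} (hX : X ∈ extHeart P d) {i : ℤ}
    (hi : i ≤ 1) (h : ∀ S ∈ 𝒮, HomVanish S X i) : ∀ M ∈ ℳ, HomVanish M X i := by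
  intro M hMM
  rw [← hM.1.2] at hMM
  refine AddClos.homVanish_src (fun M' hM' => ?_) hMM
  obtain ⟨S, hS, hM'⟩ := hM'
  obtain ⟨-, W, f, g, h', hT, hW⟩ := isHTrunc_iff.1 hM'
  exact HomVanish.src₃ hT (h S hS)
    (homVanish_of_tStr ht hW (mem_extHeart_iff.1 hX).2 (by omega))

variable (hM : IsAIRTiltingWrt P d ℳ 𝒮)

include hP ht hM

lemma isPresilting : IsPresilting 𝒮 := by
  intro A hA S hS i hi
  obtain ⟨M, hSM⟩ := exists_truncation (d := d) ht (tLe_of_mem_intervalFrom hP le_rfl (hM.1.1 hS))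
  have hMT := hM.subset_TClass (hM.hTrunc_mem hS hSM)
  obtain ⟨-, W, f, g, h, hT, hW⟩ := isHTrunc_iff.1 hSM
  exact HomVanish.tgt₂ hT (hM.homVanish_of_tLe hA hW (by omega)) (hMT.2 A hA i hi)

lemma tLe_neg_one (hd : 0 < d) {Y : C} (hY : TLe P 0 Y)
    (hSY : ∀ A ∈ 𝒮, ∀ i : ℤ, 0 ≤ i → HomVanish A Y i) : TLe P (-1) Y := by
  obtain ⟨B, hYB⟩ := exists_truncation (d := d) ht hY
  obtain ⟨hB, W, f, g, h, hT, hW⟩ := isHTrunc_iff.1 hYB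
  have hSB : ∀ A ∈ 𝒮, ∀ i : ℤ, 0 ≤ i → HomVanish A B i := fun A hA i hi =>
    HomVanish.tgt₃ hT (hSY A hA i hi) (hM.homVanish_of_tLe hA hW (by omega))
  have hBF : B ∈ Fac P d ℳ d := by
    rw [← hM.2.2]
    exact ⟨hB, fun A hA i hi => hSB A hA i hi.le⟩
  have hMB := homVanish_src ht hM hB zero_le_one (fun S hS => hSB S hS 0 le_rfl)
  obtain ⟨s, rfl⟩ := Nat.exists_eq_succ_of_ne_zero hd.ne'
  obtain ⟨Z, -, M, hMM, hZ, -, -, f', g', h', hT'⟩ := hBF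
  have hg' : g' = 0 := HomVanish.zero_iff.1 (hMB M hMM) g'
  intro p hp i hi
  rcases lt_or_eq_of_le (show 0 ≤ i by omega) with hi' | rfl
  · exact hY p hp i hi'
  · refine HomVanish.tgt₂ hT (hW p hp 0 (by push_cast; omega)) (fun a => ?_)
    obtain ⟨b, rfl⟩ := exists_lift_shift₃ hT'
      ((mem_extHeart_iff.1 hZ).1 p hp (0 + 1) (by omega)) a
    rw [hg', Functor.map_zero, comp_zero]

lemma tLe_neg (hd : 0 < d) {Y : C} (hY : TLe P 0 Y) (N : ℕ)
    (hSY : ∀ A ∈ 𝒮, ∀ i : ℤ, -(N : ℤ) < i → HomVanish A Y i) : TLe P (-N) Y := by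
  induction N with
  | zero => simpa using hY
  | succ N ih =>
    have h := ih (fun A hA i hi => hSY A hA i (by push_cast; omega))
    rw [← TLe.shift_iff (n := -1) (k := -(N : ℤ)) (by push_cast; ring)]
    refine tLe_neg_one hP ht hM hd ((TLe.shift_iff (by ring)).2 h) (fun A hA i hi => ?_)
    exact (HomVanish.shift_tgt_iff rfl).2 (hSY A hA _ (by push_cast; omega))

/-- `P[d]` is generated by `𝒮, 𝒮[1], …, 𝒮[d]`, phrased through vanishing of morphisms. -/
lemma homVanish_of_forall (hd : 0 < d) {p R : C} (hp : p ∈ P) {i : ℤ}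
    (hR : ∀ A ∈ 𝒮, ∀ j : ℤ, i ≤ j → j ≤ i + d → HomVanish A R j) : HomVanish p R i := by
  have hp0 : TLe P 0 p := fun q hq => hP q hq p hp
  have hpd : TLe P (-d) (p⟦(d : ℤ)⟧) := (TLe.shift_iff (by ring)).2 hp0
  have hS := isPresilting hP ht hM
  obtain ⟨Z, u, h1, h2, h3⟩ := exists_iterated_approx hS hM.2.1 (p⟦(d : ℤ)⟧) (d + 1)
  have hPS : ∀ q ∈ P, ∀ S ∈ 𝒮, ∀ k : ℤ, 0 < k → HomVanish q S k := fun q hq S hS =>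
    tLe_of_mem_intervalFrom hP le_rfl (hM.1.1 hS) q hq
  have hZ0 : TLe P 0 Z := by
    intro q hq k hk a
    obtain ⟨b, rfl⟩ := (h3 q (hPS q hq) k).2 hk.le a
    rw [hpd q hq k (by omega) b, zero_comp]
  have hZ : TLe P (-(d + 1 : ℕ)) Z := by
    refine tLe_neg hP ht hM hd hZ0 _ (fun A hA k hk => ?_)
    rcases le_or_gt k 0 with hk0 | hk0
    · simpa using h2 A hA (-k) (by omega) (by omega)
    · intro a
      obtain ⟨b, rfl⟩ := (h3 A (hS A hA) k).2 hk0.le a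
      rw [hM.homVanish_of_tLe hA hpd (by omega) b, zero_comp]
  have hpZ : HomVanish (p⟦(d : ℤ)⟧) Z 0 :=
    (HomVanish.shift_src_iff (n := -(d : ℤ)) (by ring)).2 (hZ p hp _ (by push_cast; omega))
  have hu : u = 0 := HomVanish.zero_iff.1 hpZ u
  rw [← HomVanish.shift_src_iff (k := (d : ℤ)) rfl]
  intro f
  obtain ⟨g, rfl⟩ := h1 R _ (fun A hA j hj0 hj =>
    hR A hA _ (by push_cast at hj; omega) (by omega)) f
  rw [hu, zero_comp]

lemma isSTorsionPair (hd : 0 < d) : IsSTorsionPair P d (Fac P d ℳ d)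
    {N | N ∈ extHeart P d ∧ ∀ M ∈ ℳ, ∀ i : ℤ, i ≤ 0 → ∀ f : M ⟶ N⟦i⟧, f = 0} := by
  refine ⟨fun T hT F hF => ?_, fun T hT F hF => ?_, fun X hX => ?_⟩
  · exact HomVanish.zero_iff.1
      (Fac_homVanish ht hF.1 hF.2 d T hT 0 le_rfl (by omega))
  · exact Fac_homVanish ht hF.1 hF.2 d T hT (-1) (by omega) (by omega)
  have hS := isPresilting hP ht hM
  obtain ⟨Z, u, -, h2, h3⟩ := exists_iterated_approx hS hM.2.1 X (2 * d)
  have hPS : ∀ q ∈ P, ∀ S ∈ 𝒮, ∀ k : ℤ, 0 < k → HomVanish q S k := fun q hq S hS =>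
    tLe_of_mem_intervalFrom hP le_rfl (hM.1.1 hS) q hq
  have hX' := mem_extHeart_iff.1 hX
  have hZ0 : TLe P 0 Z := by
    intro q hq k hk a
    obtain ⟨b, rfl⟩ := (h3 q (hPS q hq) k).2 hk.le a
    rw [hX'.1 q hq k hk b, zero_comp]
  obtain ⟨F, hZF⟩ := exists_truncation (d := d) ht hZ0
  obtain ⟨hF, W, a, q, h, hT, hW⟩ := isHTrunc_iff.1 hZF
  have hF' := mem_extHeart_iff.1 hF
  obtain ⟨E, e, c, hE⟩ := distinguished_cocone_triangle₁ (u ≫ q)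
  have hEvan {A : C} (hA : ∀ S ∈ 𝒮, ∀ k : ℤ, 0 < k → HomVanish A S k)
      (hAW : ∀ k : ℤ, 0 < k → HomVanish A W k) {i : ℤ} (hi : 0 < i) : HomVanish A E i := by
    refine HomVanish.tgt₁ hE ?_ ?_
    · intro b hb
      refine (h3 A hA i).1 hi b (map_shift_injective hT (hAW i hi) _ ?_)
      rwa [Category.assoc, ← Functor.map_comp]
    · intro b
      obtain ⟨b', rfl⟩ := exists_lift_shift₃ hT (hAW _ (by omega)) b
      obtain ⟨b'', rfl⟩ := (h3 A hA (i - 1)).2 (by omega) b'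
      exact ⟨b'', by rw [Functor.map_comp, Category.assoc]⟩
  have hEH : E ∈ extHeart P d := by
    refine mem_extHeart_iff.2 ⟨fun p hp i hi => ?_, fun p hp i hi => ?_⟩
    · exact hEvan (hPS p hp) (fun k hk => hW p hp k (by omega)) hi
    · refine HomVanish.tgt₁ hE (fun b _ => hX'.2 p hp i hi b) (fun b => ⟨0, ?_⟩)
      rw [hF'.2 p hp (i - 1) (by omega) b, zero_comp]
  refine ⟨E, ?_, F, ⟨hF, ?_⟩, hEH, hX, hF, e, u ≫ q, c, hE⟩
  · rw [← hM.2.2]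
    exact ⟨hEH, fun A hA i hi =>
      hEvan (hS A hA) (fun k hk => hM.homVanish_of_tLe hA hW (by omega)) hi⟩
  · have hWN : TLe P (-(2 * d : ℕ)) W := by
      intro p hp i hi
      rcases lt_or_ge (-(d : ℤ)) i with hi' | hi'
      · exact hW p hp i hi'
      · refine HomVanish.tgt₁ hT (fun b _ => homVanish_of_forall hP ht hM hd hp
          (fun A hA j hj hj' => ?_) b) (fun b => ⟨0, ?_⟩)
        · simpa using h2 A hA (-j) (by omega) (by omega)
        · rw [hF'.2 p hp (i - 1) (by omega) b, zero_comp]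
    intro M hMM i hi
    refine homVanish_src ht hM hF (by omega) (fun A hA => ?_) M hMM
    rcases lt_or_ge i (1 - d) with hi' | hi'
    · exact homVanish_of_tStr ht (tLe_of_mem_intervalFrom hP le_rfl (hM.1.1 hA)) hF'.2 (by omega)
    · refine HomVanish.tgt₃ hT ?_ (hM.homVanish_of_tLe hA hWN (by push_cast; omega))
      simpa using h2 A hA (-i) (by omega) (by push_cast; omega)

/-- An object of `Fac_d(ℳ)` admits a deflation from `ℳ` with kernel in `Fac_d(ℳ)`. -/
lemma exists_extriangle (hd : 0 < d) {T : C} (hTF : T ∈ Fac P d ℳ d) :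
    ∃ Z ∈ Fac P d ℳ d, ∃ M ∈ ℳ, Extriangle P d Z M T := by
  have hTT : T ∈ TClass P d 𝒮 := hM.2.2 ▸ hTF
  have hT' := mem_extHeart_iff.1 hTT.1
  obtain ⟨S, a, hS, happ⟩ := hM.2.1 T
  obtain ⟨M, hSM⟩ := exists_truncation (d := d) ht (tLe_of_mem_intervalFrom hP le_rfl (hM.1.1 hS))
  have hMM := hM.hTrunc_mem hS hSM
  obtain ⟨hMH, W, f, g, h, hSW, hW⟩ := isHTrunc_iff.1 hSM
  have hMH' := mem_extHeart_iff.1 hMH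
  have hWT : HomVanish W T 0 := homVanish_of_tStr ht hW hT'.2 (by omega)
  obtain ⟨b, hb⟩ := exists_factor₂ hSW a (HomVanish.zero_iff.1 hWT _)
  have hfac : ∀ M' ∈ ℳ, ∀ k : M' ⟶ T, ∃ l, l ≫ b = k := by
    intro M' hM'
    rw [← hM.1.2] at hM'
    refine AddClos.exists_factor b (fun N hN k => ?_) hM'
    obtain ⟨S', hS', hN⟩ := hN
    obtain ⟨-, W', f', g', h', hT', hW'⟩ := isHTrunc_iff.1 hN
    obtain ⟨l, hl⟩ := happ S' hS' (g' ≫ k)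
    have hW'M : HomVanish W' M 0 := homVanish_of_tStr ht hW' hMH'.2 (by omega)
    obtain ⟨l', hl'⟩ := exists_factor₂ hT' (l ≫ g) (HomVanish.zero_iff.1 hW'M _)
    refine ⟨l', ?_⟩
    have hz : g' ≫ (l' ≫ b - k) = 0 := by
      rw [Preadditive.comp_sub, ← Category.assoc, ← hl', Category.assoc, ← hb, hl, sub_self]
    obtain ⟨m, hm⟩ := exists_factor₃ hT' (l' ≫ b - k) hz
    have hW'T : HomVanish (W'⟦(1 : ℤ)⟧) T 0 :=
      (HomVanish.shift_src_iff (n := -1) (by ring)).2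
        (homVanish_of_tStr ht hW' (mem_extHeart_iff.1 hTT.1).2 (by omega))
    rw [HomVanish.zero_iff.1 hW'T m, comp_zero] at hm
    exact sub_eq_zero.1 hm
  obtain ⟨Z, z, δ, hZ⟩ := distinguished_cocone_triangle₁ b
  have hbδ : b ≫ δ = 0 := comp_distTriang_mor_zero₂₃ _ hZ
  have hZvan {A : C} (hAM : ∀ i : ℤ, 0 < i → HomVanish A M i)
      (hAT : ∀ i : ℤ, 0 < i → HomVanish A T i) (hAb : ∀ k : A ⟶ T, ∃ l, l ≫ b = k)
      {i : ℤ} (hi : 0 < i) : HomVanish A Z i := by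
    rcases lt_or_eq_of_le (show 1 ≤ i by omega) with hi' | rfl
    · refine HomVanish.tgt₁ hZ (fun b _ => hAM i hi b) (fun k => ⟨0, ?_⟩)
      rw [hAT (i - 1) (by omega) k, zero_comp]
    · intro k
      obtain ⟨l, hl⟩ := exists_lift₁ hZ k (hAM 1 hi _)
      obtain ⟨l', rfl⟩ := hAb l
      rw [hl, Category.assoc, hbδ, comp_zero]
  have hPb : ∀ p ∈ P, ∀ k : p ⟶ T, ∃ l, l ≫ b = k := by
    intro p hp k
    obtain ⟨s, rfl⟩ := Nat.exists_eq_succ_of_ne_zero hd.ne'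
    obtain ⟨Z', -, M', hM', hZ', -, -, f', g', h', hT''⟩ := hTF
    obtain ⟨l, hl⟩ := exists_lift₃ hT'' k
      ((mem_extHeart_iff.1 hZ').1 p hp 1 zero_lt_one _)
    obtain ⟨l', hl'⟩ := hfac M' hM' g'
    exact ⟨l ≫ l', by rw [Category.assoc, hl', hl]⟩
  have hZH : Z ∈ extHeart P d := by
    refine mem_extHeart_iff.2 ⟨fun p hp i hi => ?_, fun p hp i hi => ?_⟩
    · exact hZvan (hMH'.1 p hp) (hT'.1 p hp) (hPb p hp) hi
    · refine HomVanish.tgt₁ hZ (fun b _ => hMH'.2 p hp i hi b) (fun k => ⟨0, ?_⟩)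
      rw [hT'.2 p hp (i - 1) (by omega) k, zero_comp]
  refine ⟨Z, ?_, M, hMM, hZH, hMH, hTT.1, z, b, δ, hZ⟩
  rw [← hM.2.2]
  refine ⟨hZH, fun A hA i hi => hZvan ((hM.subset_TClass hMM).2 A hA) (hTT.2 A hA) (fun k => ?_) hi⟩
  obtain ⟨l, hl⟩ := happ A hA k
  exact ⟨l ≫ g, by rw [Category.assoc, ← hb, hl]⟩

/-- `ℳ` consists of the `Ext`-projective objects of `Fac_d(ℳ)`. -/
lemma eq_extProjectives (hd : 0 < d) :
    ℳ = {T | T ∈ Fac P d ℳ d ∧ ∀ X ∈ Fac P d ℳ d, HomVanish T X 1} := by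
  ext T
  constructor
  · intro hT
    refine ⟨hM.2.2 ▸ hM.subset_TClass hT, fun X hX => ?_⟩
    have hX : X ∈ TClass P d 𝒮 := hM.2.2 ▸ hX
    exact homVanish_src ht hM hX.1 le_rfl (fun S hS => hX.2 S hS 1 zero_lt_one) T hT
  · rintro ⟨hT, hproj⟩
    obtain ⟨Z, hZ, M, hMM, -, -, -, f, g, h, hT'⟩ := exists_extriangle hP ht hM hd hT
    obtain ⟨r, hr⟩ := exists_lift₃ hT' (𝟙 T) (hproj Z hZ _)
    rw [← hM.1.2] at hMM ⊢
    exact AddClos.summand T M r g hr.symm hMM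

end IsAIRTiltingWrt

end AIRTilting

theorem statement12
    (P : Set C) (hPpre : IsPresilting P) (m : ℤ) (hm : m < 0)
    (hP1 : ∀ X ∈ P, ∀ Y ∈ P, ∀ i : ℤ, i < m → ∀ f : X ⟶ Y⟦i⟧, f = 0)
    (hP2 : IsTStr (leZeroSet P) (geZeroSet P))
    (d : ℕ) (hd : 0 < d) :
    (∀ ℳ : Set C, IsAIRTilting P d ℳ →
      IsSTorsionPair P d (Fac P d ℳ d)
        {N | N ∈ extHeart P d ∧ ∀ M ∈ ℳ, ∀ i : ℤ, i ≤ 0 → ∀ f : M ⟶ N⟦i⟧, f = 0}) ∧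
    Set.InjOn (fun ℳ : Set C =>
        (Fac P d ℳ d,
          {N | N ∈ extHeart P d ∧ ∀ M ∈ ℳ, ∀ i : ℤ, i ≤ 0 → ∀ f : M ⟶ N⟦i⟧, f = 0}))
      {ℳ : Set C | IsAIRTilting P d ℳ} := by
  refine ⟨fun ℳ ⟨𝒮, hM⟩ => hM.isSTorsionPair hPpre hP2 hd, ?_⟩
  rintro ℳ ⟨𝒮, hM⟩ ℳ' ⟨𝒮', hM'⟩ h
  have hFac : Fac P d ℳ d = Fac P d ℳ' d := congrArg Prod.fst h
  rw [hM.eq_extProjectives hPpre hP2 hd, hFac]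
  exact (hM'.eq_extProjectives hPpre hP2 hd).symm

end PaperAIR
end
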